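/- Let d ≥ 2 and let E ⊂ ℝ^d be a compact set with Hausdorff dimension dim E = β > 0. Suppose 0 < τ < 1 and 2τ + (d−1)/2 < β < 2τ + d − 1. Then dim {x ∈ ℝ^d : dim D_x(E) < τ} ≤ 2τ − β + d − 1. -/

import Mathlib

open MeasureTheory Metric

/-- The pinned distance set `D_x(E) = {|x - y| : y ∈ E}`. -/
def pinnedDist {d : ℕ} (x : EuclideanSpace ℝ (Fin d))
    (E : Set (EuclideanSpace ℝ (Fin d))) : Set ℝ :=
  (fun y => dist x y) '' E

section Fourier
set_option linter.unusedSectionVars false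
open Set Real Module
open scoped RealInnerProductSpace Pointwise

variable {V : Type*} [NormedAddCommGroup V] [InnerProductSpace ℝ V] [FiniteDimensional ℝ V]
  [MeasurableSpace V] [BorelSpace V]

/-- The cosine transform of the surface measure on the unit sphere. -/
noncomputable def sphereCos (ξ : V) : ℝ :=
  ∫ ω : sphere (0 : V) 1, cos ⟪ξ, (ω : V)⟫ ∂(volume : Measure V).toSphere

/-- The map induced on the unit sphere by a linear isometry. -/
def sphereMap (L : V ≃ₗᵢ[ℝ] V) (ω : sphere (0 : V) 1) : sphere (0 : V) 1 :=
  ⟨L ω, by simp⟩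

lemma continuous_sphereMap (L : V ≃ₗᵢ[ℝ] V) : Continuous (sphereMap L) :=
  (L.continuous.comp continuous_subtype_val).subtype_mk _

lemma measurePreserving_sphereMap (L : V ≃ₗᵢ[ℝ] V) :
    MeasurePreserving (sphereMap L) (volume : Measure V).toSphere
      (volume : Measure V).toSphere := by
  have hm := (continuous_sphereMap L).measurable
  refine ⟨hm, Measure.ext fun s hs => ?_⟩
  rw [Measure.map_apply hm hs, Measure.toSphere_apply' _ (hm hs), Measure.toSphere_apply' _ hs]
  congr 1
  rw [← L.measurePreserving.measure_preimage_emb L.toHomeomorph.measurableEmbedding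
    (Ioo (0 : ℝ) 1 • (Subtype.val '' s))]
  congr 1
  ext v
  simp only [Set.mem_smul, mem_image, mem_preimage]
  constructor
  · rintro ⟨r, hr, w, ⟨ω, hω, rfl⟩, rfl⟩
    exact ⟨r, hr, L ω, ⟨_, hω, rfl⟩, by simp⟩
  · rintro ⟨r, hr, w, ⟨ω, hω, rfl⟩, h⟩
    refine ⟨r, hr, L.symm ω, ⟨sphereMap L.symm ω, ?_, rfl⟩, ?_⟩
    · convert hω
      ext
      simp [sphereMap]
    · apply L.injective
      simpa using h

lemma integral_sphereMap (L : V ≃ₗᵢ[ℝ] V) (f : sphere (0 : V) 1 → ℝ) :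
    ∫ ω, f (sphereMap L ω) ∂(volume : Measure V).toSphere
      = ∫ ω, f ω ∂(volume : Measure V).toSphere := by
  refine (measurePreserving_sphereMap L).integral_comp ?_ f
  have hi : Function.Injective (sphereMap L) := fun a b h => by
    ext1
    exact L.injective (congrArg Subtype.val h)
  exact (continuous_sphereMap L).measurableEmbedding hi

lemma sphereCos_eq_of_norm_eq {ξ η : V} (h : ‖ξ‖ = ‖η‖) : sphereCos ξ = sphereCos η := by
  set L : V ≃ₗᵢ[ℝ] V := (ℝ ∙ (ξ - η))ᗮ.reflection with hL
  have h1 : L ξ = η := Submodule.reflection_sub h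
  rw [sphereCos, sphereCos, ← integral_sphereMap L (fun ω => cos ⟪η, (ω : V)⟫)]
  congr 1
  ext ω
  rw [← h1]
  simp [sphereMap]

lemma integral_sphere_sin_inner (ξ : V) :
    ∫ ω : sphere (0 : V) 1, sin ⟪ξ, (ω : V)⟫ ∂(volume : Measure V).toSphere = 0 := by
  have h := integral_sphereMap (LinearIsometryEquiv.neg ℝ) (fun ω : sphere (0 : V) 1 =>
    sin ⟪ξ, (ω : V)⟫)
  simp only [sphereMap, LinearIsometryEquiv.coe_neg, inner_neg_right, sin_neg,
    integral_neg] at h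
  linarith

lemma abs_inner_sphere_le (v : V) (ω : sphere (0 : V) 1) : |⟪v, (ω : V)⟫| ≤ ‖v‖ := by
  simpa using abs_real_inner_le_norm v (ω : V)

lemma integrable_sphere_of_continuous {f : sphere (0 : V) 1 → ℝ} (hf : Continuous f) :
    Integrable f (volume : Measure V).toSphere :=
  hf.integrable_of_hasCompactSupport (HasCompactSupport.of_compactSpace f)

lemma hasDerivAt_integral_sphere_cos (ξ v : V) (g : sphere (0 : V) 1 → ℝ) (hg : Continuous g)
    (t : ℝ) :
    HasDerivAt (fun t : ℝ => ∫ ω : sphere (0 : V) 1, g ω * cos ⟪ξ + t • v, (ω : V)⟫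
        ∂(volume : Measure V).toSphere)
      (-∫ ω : sphere (0 : V) 1, g ω * (⟪v, (ω : V)⟫ * sin ⟪ξ + t • v, (ω : V)⟫)
        ∂(volume : Measure V).toSphere) t := by
  rw [← integral_neg]
  refine (hasDerivAt_integral_of_dominated_loc_of_deriv_le (s := univ)
    (F := fun t ω => g ω * cos ⟪ξ + t • v, (ω : V)⟫)
    (F' := fun t ω => -(g ω * (⟪v, (ω : V)⟫ * sin ⟪ξ + t • v, (ω : V)⟫)))
    (bound := fun ω => |g ω| * ‖v‖) Filter.univ_mem
    (.of_forall fun t => Continuous.aestronglyMeasurable (by fun_prop))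
    (integrable_sphere_of_continuous (by fun_prop))
    (Continuous.aestronglyMeasurable (by fun_prop))
    (.of_forall fun ω t _ => ?_) (integrable_sphere_of_continuous (by fun_prop))
    (.of_forall fun ω t _ => ?_)).2
  · rw [norm_neg, norm_mul, norm_mul, norm_eq_abs, norm_eq_abs, norm_eq_abs]
    gcongr
    calc _ ≤ ‖v‖ * 1 := by
          gcongr
          · exact abs_inner_sphere_le v ω
          · exact abs_sin_le_one _
      _ = _ := mul_one _
  · have h : HasDerivAt (fun t : ℝ => ⟪ξ + t • v, (ω : V)⟫) ⟪v, (ω : V)⟫ t := by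
      simp only [inner_add_left, inner_smul_left]
      simpa using ((hasDerivAt_id t).mul_const ⟪v, (ω : V)⟫).const_add ⟪ξ, (ω : V)⟫
    exact (h.cos.const_mul (g ω)).congr_deriv (by ring)

lemma hasDerivAt_integral_sphere_sin (ξ v : V) (g : sphere (0 : V) 1 → ℝ) (hg : Continuous g)
    (t : ℝ) :
    HasDerivAt (fun t : ℝ => ∫ ω : sphere (0 : V) 1, g ω * sin ⟪ξ + t • v, (ω : V)⟫
        ∂(volume : Measure V).toSphere)
      (∫ ω : sphere (0 : V) 1, g ω * (⟪v, (ω : V)⟫ * cos ⟪ξ + t • v, (ω : V)⟫)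
        ∂(volume : Measure V).toSphere) t := by
  refine (hasDerivAt_integral_of_dominated_loc_of_deriv_le (s := univ)
    (F := fun t ω => g ω * sin ⟪ξ + t • v, (ω : V)⟫)
    (F' := fun t ω => g ω * (⟪v, (ω : V)⟫ * cos ⟪ξ + t • v, (ω : V)⟫))
    (bound := fun ω => |g ω| * ‖v‖) Filter.univ_mem
    (.of_forall fun t => Continuous.aestronglyMeasurable (by fun_prop))
    (integrable_sphere_of_continuous (by fun_prop))
    (Continuous.aestronglyMeasurable (by fun_prop))
    (.of_forall fun ω t _ => ?_) (integrable_sphere_of_continuous (by fun_prop))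
    (.of_forall fun ω t _ => ?_)).2
  · rw [norm_mul, norm_mul, norm_eq_abs, norm_eq_abs, norm_eq_abs]
    gcongr
    calc _ ≤ ‖v‖ * 1 := by
          gcongr
          · exact abs_inner_sphere_le v ω
          · exact abs_cos_le_one _
      _ = _ := mul_one _
  · have h : HasDerivAt (fun t : ℝ => ⟪ξ + t • v, (ω : V)⟫) ⟪v, (ω : V)⟫ t := by
      simp only [inner_add_left, inner_smul_left]
      simpa using ((hasDerivAt_id t).mul_const ⟪v, (ω : V)⟫).const_add ⟪ξ, (ω : V)⟫
    exact (h.sin.const_mul (g ω)).congr_deriv (by ring)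

/-- The derivative of the radial profile of `sphereCos`. -/
noncomputable def sphereSin (e : V) (ρ : ℝ) : ℝ :=
  -∫ ω : sphere (0 : V) 1, ⟪e, (ω : V)⟫ * sin ⟪ρ • e, (ω : V)⟫ ∂(volume : Measure V).toSphere

lemma hasDerivAt_sphereCos (e : V) (ρ : ℝ) :
    HasDerivAt (fun ρ : ℝ => sphereCos (ρ • e)) (sphereSin e ρ) ρ := by
  simpa [sphereCos, sphereSin] using
    hasDerivAt_integral_sphere_cos (0 : V) e (fun _ => 1) continuous_const ρ

lemma hasDerivAt_sphereSin (e : V) (ρ : ℝ) :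
    HasDerivAt (sphereSin e)
      (-∫ ω : sphere (0 : V) 1, ⟪e, (ω : V)⟫ ^ 2 * cos ⟪ρ • e, (ω : V)⟫
        ∂(volume : Measure V).toSphere) ρ := by
  have := (hasDerivAt_integral_sphere_sin (0 : V) e (fun ω => ⟪e, (ω : V)⟫) (by fun_prop) ρ).neg
  simpa [sphereSin, sq, mul_assoc] using! this

/-- Differentiating the radial function `sphereCos` in a direction orthogonal to `e`. -/
lemma integral_sphere_sq_mul_cos {e v : V} (he : ‖e‖ = 1) (hv : ‖v‖ = 1) (hev : ⟪e, v⟫ = 0)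
    {ρ : ℝ} (hρ : 0 < ρ) :
    ∫ ω : sphere (0 : V) 1, ⟪v, (ω : V)⟫ ^ 2 * cos ⟪ρ • e, (ω : V)⟫
        ∂(volume : Measure V).toSphere = -sphereSin e ρ / ρ := by
  set h : ℝ → ℝ := fun t => √(ρ ^ 2 + t ^ 2) with hh
  have hpos : ∀ t, 0 < ρ ^ 2 + t ^ 2 := fun t => by positivity
  have hnorm : ∀ t : ℝ, ‖ρ • e + t • v‖ = h t := fun t => by
    rw [hh]
    refine (Real.sqrt_eq_iff_mul_self_eq (hpos t).le (norm_nonneg _)).2 ?_ |>.symm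
    rw [← sq, norm_add_sq_real]
    simp [norm_smul, he, hv, inner_smul_left, inner_smul_right, hev]
  have hd : ∀ t, HasDerivAt h (t / h t) t := fun t => by
    have := ((hasDerivAt_pow 2 t).const_add (ρ ^ 2)).sqrt (hpos t).ne'
    convert this using 1
    simp only [hh]
    field_simp
    ring
  have h1 : ∀ t, -∫ ω : sphere (0 : V) 1, ⟪v, (ω : V)⟫ * sin ⟪ρ • e + t • v, (ω : V)⟫
        ∂(volume : Measure V).toSphere = sphereSin e (h t) * (t / h t) := fun t => by
    have e1 := hasDerivAt_integral_sphere_cos (ρ • e) v (fun _ => 1) continuous_const t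
    have e2 := (hasDerivAt_sphereCos e (h t)).comp t (hd t)
    refine HasDerivAt.unique (f := fun t => sphereCos (ρ • e + t • v)) (x := t)
      (by simpa [sphereCos] using! e1) ?_
    convert! e2 using 1
    ext s
    refine sphereCos_eq_of_norm_eq ?_
    rw [hnorm, norm_smul, he, mul_one, norm_eq_abs, abs_of_nonneg (sqrt_nonneg _)]
  have hh0 : h 0 = ρ := by simp [hh, sqrt_sq hρ.le]
  have e1 := (hasDerivAt_integral_sphere_sin (ρ • e) v (fun ω => ⟪v, (ω : V)⟫) (by fun_prop) 0).neg
  have e2 : HasDerivAt (fun t => sphereSin e (h t) * (t / h t)) (sphereSin e ρ / ρ) 0 := by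
    have a1 := ((hasDerivAt_sphereSin e (h 0)).comp 0 (hd 0)).mul
      ((hasDerivAt_id (0 : ℝ)).div (hd 0) (by rw [hh0]; exact hρ.ne'))
    convert! a1 using 1
    simp [hh0]
    field_simp
  have e3 := HasDerivAt.unique (e1.congr_of_eventuallyEq (.of_forall fun t => (h1 t).symm)) e2
  simp only [zero_smul, add_zero] at e3
  rw [neg_div, ← e3, neg_neg]
  congr 1
  ext ω
  ring

lemma sphereCos_ode {e : V} (he : ‖e‖ = 1) {ρ : ℝ} (hρ : 0 < ρ) :
    HasDerivAt (sphereSin e)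
      (-sphereCos (ρ • e) - ((finrank ℝ V : ℝ) - 1) / ρ * sphereSin e ρ) ρ := by
  classical
  convert hasDerivAt_sphereSin e ρ using 1
  obtain ⟨u, b, hu, hb⟩ := Orthonormal.exists_orthonormalBasis_extension (𝕜 := ℝ) (v := {e})
    (E := V) (by simpa [orthonormal_subtype_iff_ite] using he)
  let i0 : u := ⟨e, hu rfl⟩
  have hb0 : b i0 = e := by simp [hb, i0]
  have hsum : sphereCos (ρ • e) = ∑ i : u, ∫ ω : sphere (0 : V) 1,
      ⟪b i, (ω : V)⟫ ^ 2 * cos ⟪ρ • e, (ω : V)⟫ ∂(volume : Measure V).toSphere := by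
    rw [← integral_finsetSum _ fun i _ => integrable_sphere_of_continuous (by fun_prop), sphereCos]
    congr 1
    ext ω
    rw [← Finset.sum_mul, b.sum_sq_inner_right]
    simp
  have hcard : (Finset.univ.erase i0).card = finrank ℝ V - 1 := by
    rw [Finset.card_erase_of_mem (Finset.mem_univ _), Finset.card_univ,
      finrank_eq_card_basis b.toBasis]
  have hf : 1 ≤ finrank ℝ V := by
    rw [finrank_eq_card_basis b.toBasis]
    exact Fintype.card_pos_iff.2 ⟨i0⟩
  rw [hsum, ← Finset.add_sum_erase _ _ (Finset.mem_univ i0), Finset.sum_congr rfl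
    (g := fun _ => -sphereSin e ρ / ρ) fun i hi => ?_, Finset.sum_const, hcard, hb0, nsmul_eq_mul,
    Nat.cast_sub hf]
  · push_cast
    ring
  · refine integral_sphere_sq_mul_cos he (b.norm_eq_one i) ?_ hρ
    rw [← hb0, b.inner_eq_ite, if_neg (Finset.ne_of_mem_erase hi).symm]

lemma abs_sphereCos_le (ξ : V) :
    |sphereCos ξ| ≤ (volume : Measure V).toSphere.real univ := by
  have := norm_integral_le_of_norm_le_const (μ := (volume : Measure V).toSphere)
    (f := fun ω : sphere (0 : V) 1 => cos ⟪ξ, (ω : V)⟫) (C := 1)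
    (.of_forall fun ω => abs_cos_le_one _)
  simpa [sphereCos] using this

/-- An energy estimate for a Bessel-type differential equation. -/
lemma exists_bound_of_bessel_ode {m : ℕ} (hm : 1 ≤ m) {S T : ℝ → ℝ}
    (hS : ∀ ρ, 0 < ρ → HasDerivAt S (T ρ) ρ)
    (hT : ∀ ρ, 0 < ρ → HasDerivAt T (-S ρ - m / ρ * T ρ) ρ) :
    ∃ C, ∀ ρ : ℝ, m ≤ ρ → ρ ^ m * S ρ ^ 2 ≤ C := by
  obtain ⟨k, rfl⟩ : ∃ k, m = k + 1 := ⟨m - 1, by omega⟩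
  set m' : ℝ := ((k + 1 : ℕ) : ℝ) with hm'
  have hm0 : 0 < m' := by positivity
  set F : ℝ → ℝ := fun ρ => ρ ^ (k + 1) * (S ρ ^ 2 + T ρ ^ 2) + m' * (ρ ^ k * (S ρ * T ρ))
  have hF : ∀ ρ, 0 < ρ → HasDerivAt F (-(m' * ρ ^ k / ρ * (S ρ * T ρ))) ρ := fun ρ hρ => by
    have h := ((hasDerivAt_pow (k + 1) ρ).mul (((hS ρ hρ).pow 2).add ((hT ρ hρ).pow 2))).add
      (((hasDerivAt_pow k ρ).mul ((hS ρ hρ).mul (hT ρ hρ))).const_mul m')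
    refine h.congr_deriv ?_
    have hk : (k : ℝ) * ρ ^ (k - 1) = (m' - 1) * ρ ^ k / ρ := by
      rcases k with _ | k
      · simp [hm']
      · simp only [hm', Nat.add_sub_cancel]
        push_cast
        field_simp
        ring
    rw [hk]
    simp only [Pi.add_apply, Pi.pow_apply, Pi.mul_apply, Nat.add_sub_cancel, ← hm']
    field_simp
    ring
  set G : ℝ → ℝ := fun ρ => F ρ * exp (m' / ρ)
  have hG : ∀ ρ, 0 < ρ → HasDerivAt G
      ((-(m' * ρ ^ k / ρ * (S ρ * T ρ)) - m' / ρ ^ 2 * F ρ) * exp (m' / ρ)) ρ := fun ρ hρ => by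
    have h := (hF ρ hρ).mul ((hasDerivAt_inv hρ.ne').const_mul m').exp
    simp only [← div_eq_mul_inv] at h
    refine h.congr_deriv ?_
    ring
  have hlow : ∀ ρ, m' ≤ ρ → ρ ^ (k + 1) * (S ρ ^ 2 + T ρ ^ 2) ≤ 2 * F ρ := fun ρ hρ => by
    have hρ0 : 0 < ρ := hm0.trans_le hρ
    have h1 : -(m' * (S ρ * T ρ)) ≤ ρ * ((S ρ ^ 2 + T ρ ^ 2) / 2) :=
      calc -(m' * (S ρ * T ρ)) ≤ m' * ((S ρ ^ 2 + T ρ ^ 2) / 2) := by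
            nlinarith [sq_nonneg (S ρ + T ρ)]
        _ ≤ _ := by gcongr
    have h2 := mul_le_mul_of_nonneg_left h1 (pow_nonneg hρ0.le k)
    simp only [F, pow_succ ρ k]
    linarith
  have hanti : AntitoneOn G (Ici m') := by
    refine antitoneOn_of_deriv_nonpos (convex_Ici _)
      (fun ρ hρ => (hG ρ (hm0.trans_le hρ)).continuousAt.continuousWithinAt)
      (fun ρ hρ => ?_) (fun ρ hρ => ?_)
    · rw [interior_Ici] at hρ
      exact (hG ρ (hm0.trans hρ)).differentiableAt.differentiableWithinAt
    · rw [interior_Ici] at hρ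
      have hρ0 : 0 < ρ := hm0.trans hρ
      rw [(hG ρ hρ0).deriv]
      refine mul_nonpos_of_nonpos_of_nonneg ?_ (exp_pos _).le
      have h1 := hlow ρ (le_of_lt hρ)
      have h2 : -(S ρ * T ρ) ≤ (S ρ ^ 2 + T ρ ^ 2) / 2 := by nlinarith [sq_nonneg (S ρ + T ρ)]
      have h3 : -(m' * ρ ^ k / ρ * (S ρ * T ρ)) ≤ m' / ρ ^ 2 * F ρ :=
        calc -(m' * ρ ^ k / ρ * (S ρ * T ρ)) = m' * ρ ^ k / ρ * -(S ρ * T ρ) := by ring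
          _ ≤ m' * ρ ^ k / ρ * ((S ρ ^ 2 + T ρ ^ 2) / 2) := by gcongr
          _ = m' / ρ ^ 2 * (ρ ^ (k + 1) * (S ρ ^ 2 + T ρ ^ 2) / 2) := by
            field_simp
            ring
          _ ≤ m' / ρ ^ 2 * F ρ := by
            gcongr
            linarith
      linarith
  refine ⟨2 * G m', fun ρ hρ => ?_⟩
  have hρ0 : 0 < ρ := hm0.trans_le hρ
  have hF0 : 0 ≤ F ρ := by
    have := hlow ρ hρ
    have : 0 ≤ ρ ^ (k + 1) * (S ρ ^ 2 + T ρ ^ 2) := by positivity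
    linarith
  calc ρ ^ (k + 1) * S ρ ^ 2 ≤ ρ ^ (k + 1) * (S ρ ^ 2 + T ρ ^ 2) := by
        gcongr
        nlinarith [sq_nonneg (T ρ)]
    _ ≤ 2 * F ρ := hlow ρ hρ
    _ ≤ 2 * G ρ := by
        gcongr
        exact le_mul_of_one_le_right hF0 (one_le_exp (by positivity))
    _ ≤ 2 * G m' := by
        gcongr
        exact hanti self_mem_Ici hρ hρ

lemma exists_sphereCos_decay (hV : 2 ≤ finrank ℝ V) :
    ∃ C, 0 < C ∧ ∀ ξ : V, ‖ξ‖ ^ (finrank ℝ V - 1) * sphereCos ξ ^ 2 ≤ C := by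
  have : Nontrivial V := nontrivial_of_finrank_pos (R := ℝ) (by omega)
  obtain ⟨e, he⟩ := exists_norm_eq V zero_le_one
  set m := finrank ℝ V - 1 with hm
  have hcast : (m : ℝ) = (finrank ℝ V : ℝ) - 1 := by
    rw [hm, Nat.cast_sub (by omega)]
    simp
  obtain ⟨C, hC⟩ := exists_bound_of_bessel_ode (m := m) (by omega)
    (fun ρ _ => hasDerivAt_sphereCos e ρ)
    (fun ρ hρ => by rw [hcast]; exact sphereCos_ode he hρ)
  set A := (volume : Measure V).toSphere.real univ
  refine ⟨max C ((m : ℝ) ^ m * A ^ 2) + 1, ?_, fun ξ => ?_⟩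
  · have : 0 ≤ (m : ℝ) ^ m * A ^ 2 := by positivity
    linarith [le_max_right C ((m : ℝ) ^ m * A ^ 2)]
  rcases le_total (m : ℝ) ‖ξ‖ with h | h
  · have h1 := hC ‖ξ‖ h
    rw [sphereCos_eq_of_norm_eq (ξ := ‖ξ‖ • e) (η := ξ) (by simp [norm_smul, he])] at h1
    linarith [le_max_left C ((m : ℝ) ^ m * A ^ 2)]
  · have h1 : ‖ξ‖ ^ m * sphereCos ξ ^ 2 ≤ (m : ℝ) ^ m * A ^ 2 := by
      gcongr ?_ * ?_
      · gcongr
      · rw [← sq_abs]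
        gcongr
        exact abs_sphereCos_le ξ
    linarith [le_max_right C ((m : ℝ) ^ m * A ^ 2)]

lemma integral_eq_integral_Ioi_sphere [Nontrivial V] {f : V → ℝ} (hf : Integrable f) :
    ∫ x, f x = ∫ y in Ioi (0 : ℝ), y ^ (finrank ℝ V - 1) *
      ∫ ω : sphere (0 : V) 1, f (y • (ω : V)) ∂(volume : Measure V).toSphere := by
  set μ : Measure V := volume
  have hmp := μ.measurePreserving_homeomorphUnitSphereProd
  have hme := (homeomorphUnitSphereProd V).measurableEmbedding
  set g : sphere (0 : V) 1 × Ioi (0 : ℝ) → ℝ := fun p => f ((p.2 : ℝ) • (p.1 : V))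
  have hg : ∀ x : ({(0)}ᶜ : Set V), g (homeomorphUnitSphereProd V x) = f x := fun x => by
    have hx : ‖(x : V)‖ ≠ 0 := norm_ne_zero_iff.2 x.2
    simp [g, smul_smul, hx]
  have h_integrable : Integrable g (μ.toSphere.prod (.volumeIoiPow (finrank ℝ V - 1))) := by
    rw [← hmp.integrable_comp_emb hme]
    have : g ∘ homeomorphUnitSphereProd V = f ∘ Subtype.val := funext hg
    rw [this, ← integrableOn_iff_comap_subtypeVal (measurableSet_singleton _).compl]
    exact hf.integrableOn
  calc
    ∫ x, f x = ∫ x : ({(0)}ᶜ : Set V), f x ∂(μ.comap (↑)) := by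
      rw [integral_subtype_comap (measurableSet_singleton _).compl f, restrict_compl_singleton]
    _ = ∫ p, g p ∂μ.toSphere.prod (.volumeIoiPow (finrank ℝ V - 1)) := by
      rw [← hmp.integral_comp hme]
      exact integral_congr_ae (.of_forall fun x => (hg x).symm)
    _ = ∫ y, ∫ ω, g (ω, y) ∂μ.toSphere ∂(.volumeIoiPow (finrank ℝ V - 1)) :=
      integral_prod_symm g h_integrable
    _ = _ := by
      simp only [Measure.volumeIoiPow, ENNReal.ofReal, g]
      rw [integral_withDensity_eq_integral_smul,
        integral_subtype_comap measurableSet_Ioi fun a : ℝ ↦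
          Real.toNNReal (a ^ (finrank ℝ V - 1)) • ∫ ω, f (a • (ω : V)) ∂μ.toSphere,
        setIntegral_congr_fun measurableSet_Ioi fun x hx ↦ ?_]
      · rw [NNReal.smul_def, Real.coe_toNNReal _ (pow_nonneg hx.out.le _), smul_eq_mul]
      · exact (measurable_subtype_coe.pow_const _).real_toNNReal

/-- Spherical caps of radius `t` have surface measure at least a multiple of `t ^ (dim - 1)`. -/
lemma exists_toSphere_cap_ge [Nontrivial V] : ∃ c : ℝ, 0 < c ∧ ∀ (e : V) (t : ℝ), ‖e‖ = 1 →
    0 < t → t ≤ 1 →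
    c * t ^ (finrank ℝ V - 1) ≤
      (volume : Measure V).toSphere.real {ω | ‖(ω : V) - e‖ < t} := by
  set n := finrank ℝ V with hn
  have hn0 : 0 < n := finrank_pos
  set B := (volume : Measure V).real (ball 0 1)
  have hB : 0 < B := by
    simp only [B, Measure.real]
    exact ENNReal.toReal_pos (measure_ball_pos _ _ one_pos).ne' measure_ball_lt_top.ne
  refine ⟨B / (2 ^ n * 2 ^ (n - 1)), by positivity, fun e t he ht ht1 => ?_⟩
  set σ := (volume : Measure V).toSphere
  set s := σ.real {ω | ‖(ω : V) - e‖ < t}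
  have hs : 0 ≤ s := measureReal_nonneg
  have hball : (volume : Measure V).real (ball e (t / 2)) = (t / 2) ^ n * B := by
    rw [Measure.real, Measure.addHaar_ball_of_pos _ _ (by positivity), ENNReal.toReal_mul,
      ENNReal.toReal_ofReal (by positivity)]
    rfl
  have h_integrable : Integrable ((ball e (t / 2)).indicator (1 : V → ℝ)) := by
    rw [integrable_indicator_iff measurableSet_ball]
    exact integrableOn_const measure_ball_lt_top.ne
  have h1 := integral_eq_integral_Ioi_sphere h_integrable
  rw [integral_indicator_one measurableSet_ball, hball] at h1
  have hcap : MeasurableSet {ω : sphere (0 : V) 1 | ‖(ω : V) - e‖ < t} :=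
    measurableSet_lt (by fun_prop) measurable_const
  have h2 : (t / 2) ^ n * B ≤ ∫ y in Ioi (0 : ℝ),
      (Icc (1 - t / 2) (1 + t / 2)).indicator (fun _ => 2 ^ (n - 1) * s) y := by
    rw [h1]
    refine integral_mono_of_nonneg ?_ ?_ ?_
    · filter_upwards [ae_restrict_mem measurableSet_Ioi] with y hy
      exact mul_nonneg (pow_nonneg (le_of_lt hy) _)
        (integral_nonneg fun ω => indicator_nonneg (fun _ _ => zero_le_one) _)
    · rw [integrable_indicator_iff measurableSet_Icc]
      refine integrableOn_const (ne_top_of_le_ne_top ?_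
        (Measure.restrict_apply_le _ _))
      simp
    · filter_upwards [ae_restrict_mem measurableSet_Ioi] with y hy
      have hy0 : 0 < y := hy
      have hdist : ∀ ω : sphere (0 : V) 1, |y - 1| ≤ ‖y • (ω : V) - e‖ := fun ω => by
        have := abs_norm_sub_norm_le (y • (ω : V)) e
        simpa [norm_smul, he, abs_of_pos hy0] using this
      by_cases hyI : y ∈ Icc (1 - t / 2) (1 + t / 2)
      · rw [indicator_of_mem hyI]
        have hy2 : y ≤ 2 := by linarith [hyI.2]
        gcongr
        · exact integral_nonneg fun ω => indicator_nonneg (fun _ _ => zero_le_one) _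
        · simp only [s]
          rw [← integral_indicator_one hcap]
          refine integral_mono_of_nonneg
            (.of_forall fun ω => indicator_nonneg (fun _ _ => zero_le_one) _)
            ((integrable_indicator_iff hcap).2 (integrableOn_const (measure_ne_top _ _)))
            (.of_forall fun ω => ?_)
          by_cases hω : y • (ω : V) ∈ ball e (t / 2)
          · have hω' : ω ∈ {ω : sphere (0 : V) 1 | ‖(ω : V) - e‖ < t} := by
              rw [mem_ball, dist_eq_norm] at hω
              have h3 : ‖(ω : V) - y • (ω : V)‖ = |y - 1| := by
                rw [← norm_neg, neg_sub, show y • (ω : V) - ω = (y - 1) • (ω : V) by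
                  rw [sub_smul, one_smul], norm_smul]
                simp
              have h4 := norm_sub_le_norm_sub_add_norm_sub (ω : V) (y • (ω : V)) e
              simp only [mem_ofPred_eq]
              linarith [hdist ω]
            simp only [indicator_of_mem hω, indicator_of_mem hω', le_refl, Pi.one_apply]
          · simp only [indicator_of_notMem hω]
            exact indicator_nonneg (fun _ _ => zero_le_one) _
      · rw [indicator_of_notMem hyI]
        have : ∀ ω : sphere (0 : V) 1, (ball e (t / 2)).indicator (1 : V → ℝ) (y • (ω : V)) = 0 := by
          refine fun ω => indicator_of_notMem (fun hω => hyI ?_) _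
          rw [mem_ball, dist_eq_norm] at hω
          have := abs_lt.1 ((hdist ω).trans_lt hω)
          constructor <;> linarith [this.1, this.2]
        simp [this]
  have h3 : ∫ y in Ioi (0 : ℝ), (Icc (1 - t / 2) (1 + t / 2)).indicator
      (fun _ => 2 ^ (n - 1) * s) y = t * (2 ^ (n - 1) * s) := by
    rw [setIntegral_indicator measurableSet_Icc, setIntegral_const,
      inter_eq_self_of_subset_right (fun y hy => mem_Ioi.2 (by linarith [(mem_Icc.1 hy).1]))]
    rw [Real.volume_real_Icc_of_le (by linarith), smul_eq_mul]
    ring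
  rw [h3] at h2
  obtain ⟨k, hk⟩ : ∃ k, n = k + 1 := ⟨n - 1, by omega⟩
  rw [hk, Nat.add_sub_cancel] at h2 ⊢
  rw [div_mul_eq_mul_div, div_le_iff₀ (by positivity)]
  refine le_of_mul_le_mul_left ?_ ht
  have h4 := mul_le_mul_of_nonneg_left h2 (by positivity : (0 : ℝ) ≤ 2 ^ (k + 1))
  calc t * (B * t ^ k) = 2 ^ (k + 1) * ((t / 2) ^ (k + 1) * B) := by
        rw [div_pow]
        field_simp
        ring
    _ ≤ _ := h4
    _ = _ := by ring

lemma integrable_exp_neg_mul_sq_norm {v : ℝ} (hv : 0 < v) :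
    Integrable (fun ξ : V => exp (-(v * ‖ξ‖ ^ 2))) := by
  have h := GaussianFourier.integrable_cexp_neg_mul_sq_norm_add (V := V)
    (b := (v : ℂ)) (by simpa using hv) 0 0
  refine h.norm.congr (.of_forall fun ξ => ?_)
  simp only [Complex.norm_exp]
  congr 1
  simp [← Complex.ofReal_pow]

lemma integral_exp_neg_mul_sq_norm_mul_cos {v : ℝ} (hv : 0 < v) (z : V) :
    ∫ ξ : V, exp (-(v * ‖ξ‖ ^ 2)) * cos ⟪z, ξ⟫ =
      (π / v) ^ ((finrank ℝ V : ℝ) / 2) * exp (-(‖z‖ ^ 2 / (4 * v))) := by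
  have h := GaussianFourier.integral_cexp_neg_mul_sq_norm_add (V := V)
    (b := (v : ℂ)) (by simpa using hv) Complex.I z
  have hi := GaussianFourier.integrable_cexp_neg_mul_sq_norm_add (V := V)
    (b := (v : ℂ)) (by simpa using hv) Complex.I z
  have h2 := congrArg Complex.re h
  rw [← RCLike.re_eq_complex_re, ← integral_re hi] at h2
  convert h2 using 1
  · refine integral_congr_ae (.of_forall fun ξ => ?_)
    simp [Complex.exp_re, ← Complex.ofReal_pow]
  · rw [RCLike.re_eq_complex_re, show ((π : ℂ) / (v : ℂ)) ^ ((finrank ℝ V : ℂ) / 2) *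
      Complex.exp (Complex.I ^ 2 * (‖z‖ : ℂ) ^ 2 / (4 * (v : ℂ))) =
      (((π / v) ^ ((finrank ℝ V : ℝ) / 2) * exp (-(‖z‖ ^ 2 / (4 * v))) : ℝ) : ℂ) by
        push_cast [Complex.ofReal_cpow (by positivity : 0 ≤ π / v)]
        rw [Complex.I_sq]
        congr 2
        ring]
    exact (Complex.ofReal_re _).symm

lemma abs_mul_cos_le {g : ℝ} (t : ℝ) : |g * cos t| ≤ |g| := by
  rw [abs_mul]
  exact mul_le_of_le_one_right (abs_nonneg _) (abs_cos_le_one _)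

lemma continuous_sphereCos : Continuous (sphereCos : V → ℝ) := by
  refine continuous_of_dominated (bound := fun _ => 1)
    (fun ξ => (Continuous.aestronglyMeasurable (by fun_prop)))
    (fun ξ => .of_forall fun ω => abs_cos_le_one _) (integrable_const _)
    (.of_forall fun ω => by fun_prop)

/-- The cosine transform of a sphere is concentrated near that sphere, after mollification. -/
lemma exists_integral_gauss_sphereCos_ge [Nontrivial V] (r₁ : ℝ) : ∃ c : ℝ, 0 < c ∧
    ∀ (δ r : ℝ) (w : V), 0 < δ → 
      0 ≤ ∫ ξ : V, exp (-(δ ^ 2 * ‖ξ‖ ^ 2)) * (sphereCos (r • ξ) * cos ⟪w, ξ⟫) ∧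
      (δ ≤ 1 → 0 ≤ r → r ≤ r₁ → |‖w‖ - r| ≤ δ →
      c * δ⁻¹ ≤ ∫ ξ : V, exp (-(δ ^ 2 * ‖ξ‖ ^ 2)) * (sphereCos (r • ξ) * cos ⟪w, ξ⟫)) := by
  obtain ⟨c, hc, hcap⟩ := exists_toSphere_cap_ge (V := V)
  set n := finrank ℝ V with hn
  set σ := (volume : Measure V).toSphere with hσ
  set M := exp (-((|r₁| + 1) ^ 2 / 4))
  refine ⟨c * π ^ ((n : ℝ) / 2) * M, by positivity, fun δ r w hδ => ?_⟩
  have hδ2 : 0 < δ ^ 2 := by positivity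
  have key : ∫ ξ : V, exp (-(δ ^ 2 * ‖ξ‖ ^ 2)) * (sphereCos (r • ξ) * cos ⟪w, ξ⟫) =
      ∫ ω : sphere (0 : V) 1, (π / δ ^ 2) ^ ((n : ℝ) / 2) *
        exp (-(‖r • (ω : V) - w‖ ^ 2 / (4 * δ ^ 2))) ∂σ := by
    simp_rw [hn, ← integral_exp_neg_mul_sq_norm_mul_cos hδ2]
    rw [integral_integral_swap]
    · refine integral_congr_ae (.of_forall fun ξ => ?_)
      beta_reduce
      rw [integral_const_mul]
      congr 1
      have h1 : ∀ ω : sphere (0 : V) 1, cos ⟪r • (ω : V) - w, ξ⟫ =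
          cos ⟪r • ξ, (ω : V)⟫ * cos ⟪w, ξ⟫ + sin ⟪r • ξ, (ω : V)⟫ * sin ⟪w, ξ⟫ := fun ω => by
        rw [inner_sub_left, cos_sub, real_inner_smul_left, real_inner_smul_left,
          real_inner_comm (ω : V) ξ]
      simp_rw [h1]
      rw [integral_add (integrable_sphere_of_continuous (by fun_prop))
        (integrable_sphere_of_continuous (by fun_prop)), integral_mul_const, integral_mul_const,
        integral_sphere_sin_inner]
      simp [sphereCos]
    · have h2 : Integrable (fun p : sphere (0 : V) 1 × V => (1 : ℝ) * exp (-(δ ^ 2 * ‖p.2‖ ^ 2)))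
          (σ.prod volume) := (integrable_const (1 : ℝ)).mul_prod (integrable_exp_neg_mul_sq_norm hδ2)
      refine h2.mono' (Continuous.aestronglyMeasurable (by fun_prop)) (.of_forall fun p => ?_)
      simpa [Function.uncurry] using
        abs_mul_cos_le (g := exp (-(δ ^ 2 * ‖p.2‖ ^ 2))) ⟪r • (p.1 : V) - w, p.2⟫
  rw [key]
  refine ⟨integral_nonneg fun ω => by positivity, fun hδ1 hr hr1 hw => ?_⟩
  obtain ⟨e, he, hwe⟩ : ∃ e : V, ‖e‖ = 1 ∧ w = ‖w‖ • e := by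
    by_cases hw0 : w = 0
    · obtain ⟨e, he⟩ := exists_norm_eq V zero_le_one
      exact ⟨e, he, by simp [hw0]⟩
    · have := norm_ne_zero_iff.2 hw0
      exact ⟨‖w‖⁻¹ • w, by simp [norm_smul, this], by simp [smul_smul, this]⟩
  have hcapm : MeasurableSet {ω : sphere (0 : V) 1 | ‖(ω : V) - e‖ < δ} :=
    measurableSet_lt (by fun_prop) measurable_const
  have h3 : ∀ ω ∈ {ω : sphere (0 : V) 1 | ‖(ω : V) - e‖ < δ},
      M ≤ exp (-(‖r • (ω : V) - w‖ ^ 2 / (4 * δ ^ 2))) := fun ω hω => by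
    rw [mem_ofPred_eq] at hω
    have h4 : ‖r • (ω : V) - w‖ ≤ (|r₁| + 1) * δ := by
      have h5 : r • (ω : V) - w = r • ((ω : V) - e) + (r - ‖w‖) • e := by
        nth_rewrite 1 [hwe]
        rw [smul_sub, sub_smul]
        abel
      rw [h5]
      refine (norm_add_le _ _).trans ?_
      rw [norm_smul, norm_smul, he, mul_one, norm_eq_abs, norm_eq_abs, abs_of_nonneg hr,
        abs_sub_comm r]
      have : r * ‖(ω : V) - e‖ ≤ |r₁| * δ :=
        mul_le_mul (hr1.trans (le_abs_self _)) hω.le (norm_nonneg _) (abs_nonneg _)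
      linarith
    refine exp_le_exp.2 (neg_le_neg ?_)
    rw [div_le_div_iff₀ (by positivity) (by positivity)]
    have := pow_le_pow_left₀ (norm_nonneg _) h4 2
    nlinarith
  calc c * π ^ ((n : ℝ) / 2) * M * δ⁻¹ =
        (c * δ ^ (n - 1)) * ((π / δ ^ 2) ^ ((n : ℝ) / 2) * M) := by
        have hn0 : 0 < n := finrank_pos
        rw [div_rpow pi_nonneg hδ2.le, ← rpow_natCast δ 2, ← rpow_mul hδ.le,
          ← rpow_natCast δ (n - 1), show ((2 : ℕ) : ℝ) * ((n : ℝ) / 2) = n by push_cast; ring,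
          Nat.cast_sub (by omega), rpow_sub hδ]
        have : (0 : ℝ) < δ ^ (n : ℝ) := by positivity
        field_simp
        simp
    _ ≤ σ.real {ω : sphere (0 : V) 1 | ‖(ω : V) - e‖ < δ} *
        ((π / δ ^ 2) ^ ((n : ℝ) / 2) * M) := by
        gcongr
        exact hcap e δ he hδ hδ1
    _ = ∫ ω in {ω : sphere (0 : V) 1 | ‖(ω : V) - e‖ < δ}, (π / δ ^ 2) ^ ((n : ℝ) / 2) * M ∂σ := by
        simp
    _ ≤ ∫ ω in {ω : sphere (0 : V) 1 | ‖(ω : V) - e‖ < δ}, (π / δ ^ 2) ^ ((n : ℝ) / 2) *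
        exp (-(‖r • (ω : V) - w‖ ^ 2 / (4 * δ ^ 2))) ∂σ := by
        refine setIntegral_mono_on (integrable_const _)
          (integrable_sphere_of_continuous (by fun_prop)).integrableOn hcapm fun ω hω => ?_
        gcongr
        exact h3 ω hω
    _ ≤ _ := by
        refine setIntegral_le_integral (integrable_sphere_of_continuous (by fun_prop))
          (.of_forall fun ω => ?_)
        simp only [Pi.zero_apply]
        positivity

lemma sq_sum_cos_add_sq_sum_sin {ι : Type*} (s : Finset ι) (a θ : ι → ℝ) :
    (∑ i ∈ s, a i * cos (θ i)) ^ 2 + (∑ i ∈ s, a i * sin (θ i)) ^ 2 =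
      ∑ i ∈ s, ∑ j ∈ s, a i * a j * cos (θ i - θ j) := by
  rw [sq, sq, Finset.sum_mul_sum, Finset.sum_mul_sum, ← Finset.sum_add_distrib]
  refine Finset.sum_congr rfl fun i _ => ?_
  rw [← Finset.sum_add_distrib]
  refine Finset.sum_congr rfl fun j _ => ?_
  rw [cos_sub]
  ring

lemma lintegral_rpow_mul_add_rpow_le {α β ε : ℝ} (hα : 0 < α) (hαβ : α < β) (hε : 0 < ε) :
    ∫⁻ u in Ioi (0 : ℝ), ENNReal.ofReal (u ^ (α - 1) * (u + ε) ^ (-β)) ≤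
      ENNReal.ofReal ((α⁻¹ + (β - α)⁻¹) * ε ^ (α - β)) := by
  rw [← Ioc_union_Ioi_eq_Ioi hε.le, lintegral_union measurableSet_Ioi
    (Set.Ioc_disjoint_Ioi le_rfl), add_mul,
    ENNReal.ofReal_add (by positivity) (mul_nonneg (by simpa using hαβ.le) (by positivity))]
  gcongr
  · calc ∫⁻ u in Ioc 0 ε, ENNReal.ofReal (u ^ (α - 1) * (u + ε) ^ (-β)) ≤
          ∫⁻ u in Ioc 0 ε, ENNReal.ofReal (u ^ (α - 1) * ε ^ (-β)) := by
          refine setLIntegral_mono' measurableSet_Ioc fun u hu => ENNReal.ofReal_le_ofReal ?_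
          have := hu.1
          gcongr ?_ * ?_
          exact rpow_le_rpow_of_nonpos hε (by linarith) (by linarith)
      _ = ENNReal.ofReal (∫ u in Ioc 0 ε, u ^ (α - 1) * ε ^ (-β)) := by
          rw [ofReal_integral_eq_lintegral_ofReal]
          · rw [← IntegrableOn, ← intervalIntegrable_iff_integrableOn_Ioc_of_le hε.le]
            exact (intervalIntegral.intervalIntegrable_rpow' (by linarith)).mul_const _
          · filter_upwards [ae_restrict_mem measurableSet_Ioc] with u hu
            have := hu.1
            simp only [Pi.zero_apply]
            positivity
      _ ≤ _ := by
          apply le_of_eq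
          rw [integral_mul_const, ← intervalIntegral.integral_of_le hε.le,
            integral_rpow (Or.inl (by linarith)), sub_add_cancel, zero_rpow hα.ne', sub_zero,
            sub_eq_add_neg α β, rpow_add hε]
          congr 1
          ring
  · calc ∫⁻ u in Ioi ε, ENNReal.ofReal (u ^ (α - 1) * (u + ε) ^ (-β)) ≤
          ∫⁻ u in Ioi ε, ENNReal.ofReal (u ^ (α - 1 - β)) := by
          refine setLIntegral_mono' measurableSet_Ioi fun u hu => ENNReal.ofReal_le_ofReal ?_
          have hu0 : 0 < u := hε.trans hu
          rw [sub_eq_add_neg (α - 1), rpow_add hu0]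
          gcongr ?_ * ?_
          exact rpow_le_rpow_of_nonpos hu0 (by linarith) (by linarith)
      _ = ENNReal.ofReal (∫ u in Ioi ε, u ^ (α - 1 - β)) := by
          rw [ofReal_integral_eq_lintegral_ofReal]
          · exact integrableOn_Ioi_rpow_of_lt (by linarith) hε
          · filter_upwards [ae_restrict_mem measurableSet_Ioi] with u hu
            have : 0 < u := hε.trans hu
            simp only [Pi.zero_apply]
            positivity
      _ ≤ _ := by
          apply le_of_eq
          rw [integral_Ioi_rpow_of_lt (by linarith) hε, show α - 1 - β + 1 = -(β - α) by ring,
            neg_div_neg_eq, neg_sub]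
          congr 1
          ring

lemma lintegral_rpow_mul_exp_neg_mul {α ρ : ℝ} (hα : 0 < α) (hρ : 0 < ρ) :
    ∫⁻ u in Ioi (0 : ℝ), ENNReal.ofReal (u ^ (α - 1) * exp (-(ρ * u))) =
      ENNReal.ofReal (ρ ^ (-α) * Gamma α) := by
  rw [← ofReal_integral_eq_lintegral_ofReal, integral_rpow_mul_exp_neg_mul_Ioi hα hρ, one_div,
    inv_rpow hρ.le, rpow_neg hρ.le]
  · have := integrableOn_rpow_mul_exp_neg_mul_rpow (s := α - 1) (p := 1) (by linarith) one_pos hρ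
    simpa [IntegrableOn] using this
  · filter_upwards [ae_restrict_mem measurableSet_Ioi] with u hu
    have : 0 < u := hu
    simp only [Pi.zero_apply]
    positivity

/-- The squared modulus of the Fourier transform of a finitely supported measure. -/
noncomputable def fourierSq (G : Finset V) (μ : V → ℝ) (ξ : V) : ℝ :=
  (∑ y ∈ G, μ y * cos ⟪y, ξ⟫) ^ 2 + (∑ y ∈ G, μ y * sin ⟪y, ξ⟫) ^ 2

lemma fourierSq_nonneg (G : Finset V) (μ : V → ℝ) (ξ : V) : 0 ≤ fourierSq G μ ξ := by
  unfold fourierSq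
  positivity

lemma continuous_fourierSq (G : Finset V) (μ : V → ℝ) : Continuous (fourierSq G μ) := by
  unfold fourierSq
  fun_prop

lemma integral_exp_mul_fourierSq {v : ℝ} (hv : 0 < v) (G : Finset V) (μ : V → ℝ) :
    Integrable (fun ξ => exp (-(v * ‖ξ‖ ^ 2)) * fourierSq G μ ξ) ∧
    ∫ ξ, exp (-(v * ‖ξ‖ ^ 2)) * fourierSq G μ ξ =
      (π / v) ^ ((finrank ℝ V : ℝ) / 2) *
        ∑ y ∈ G, μ y * ∑ y' ∈ G, μ y' * exp (-(‖y - y'‖ / (2 * √v)) ^ 2) := by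
  have hi : ∀ y y' : V, Integrable (fun ξ => μ y * μ y' *
      (exp (-(v * ‖ξ‖ ^ 2)) * cos ⟪y - y', ξ⟫)) := fun y y' =>
    ((integrable_exp_neg_mul_sq_norm hv).mono' (Continuous.aestronglyMeasurable (by fun_prop))
      (.of_forall fun ξ => by
        simpa using abs_mul_cos_le (g := exp (-(v * ‖ξ‖ ^ 2))) ⟪y - y', ξ⟫)).const_mul _
  have h : ∀ ξ, exp (-(v * ‖ξ‖ ^ 2)) * fourierSq G μ ξ = ∑ y ∈ G, ∑ y' ∈ G, μ y * μ y' *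
      (exp (-(v * ‖ξ‖ ^ 2)) * cos ⟪y - y', ξ⟫) := fun ξ => by
    rw [fourierSq, sq_sum_cos_add_sq_sum_sin, Finset.mul_sum]
    refine Finset.sum_congr rfl fun y _ => ?_
    rw [Finset.mul_sum]
    refine Finset.sum_congr rfl fun y' _ => ?_
    rw [inner_sub_left]
    ring
  simp_rw [h]
  refine ⟨integrable_finsetSum _ fun y _ => integrable_finsetSum _ fun y' _ => hi y y', ?_⟩
  rw [integral_finsetSum _ fun y _ => integrable_finsetSum _ fun y' _ => hi y y', Finset.mul_sum]
  refine Finset.sum_congr rfl fun y _ => ?_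
  rw [integral_finsetSum _ fun y' _ => hi y y', Finset.mul_sum, Finset.mul_sum]
  refine Finset.sum_congr rfl fun y' _ => ?_
  rw [integral_const_mul, integral_exp_neg_mul_sq_norm_mul_cos hv, div_pow, mul_pow, sq_sqrt hv.le]
  norm_num
  ring

/-- The Riesz energy of a mollified measure satisfying a Frostman condition. -/
lemma exists_energy_le [Nontrivial V] {a b : ℝ} (ha : 0 < a) (hab : a + b < finrank ℝ V) :
    ∃ C : ℝ, 0 < C ∧ ∀ (δ K : ℝ) (G : Finset V) (μ : V → ℝ), 0 < δ → 0 ≤ K →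
      (∀ y ∈ G, 0 ≤ μ y) →
      (∀ t, δ ≤ t → ∀ y ∈ G, ∑ y' ∈ G, μ y' * exp (-(‖y - y'‖ / t) ^ 2) ≤ K * t ^ b) →
      ∑ y ∈ G, μ y ≤ K →
      Integrable (fun ξ => ‖ξ‖ ^ (-a) * (exp (-(δ ^ 2 * ‖ξ‖ ^ 2)) * fourierSq G μ ξ)) ∧
      ∫ ξ, ‖ξ‖ ^ (-a) * (exp (-(δ ^ 2 * ‖ξ‖ ^ 2)) * fourierSq G μ ξ) ≤
        C * K ^ 2 * δ ^ (a + b - finrank ℝ V) := by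
  set n := finrank ℝ V with hn
  have hΓ : 0 < Gamma (a / 2) := Gamma_pos_of_pos (by positivity)
  set C₁ : ℝ := π ^ ((n : ℝ) / 2) * 2 ^ b
  set C₂ : ℝ := (a / 2)⁻¹ + ((n - b) / 2 - a / 2)⁻¹
  have hC₂ : 0 < C₂ := add_pos (by positivity) (inv_pos.2 (by linarith))
  refine ⟨(Gamma (a / 2))⁻¹ * (C₁ * C₂), by positivity, fun δ K G μ hδ hK hμ hF hμK => ?_⟩
  set g := fourierSq G μ
  have hg0 : ∀ ξ, 0 ≤ g ξ := fourierSq_nonneg G μ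
  have hgc : Continuous g := continuous_fourierSq G μ
  have hgauss : ∀ v, δ ^ 2 ≤ v → ∫ ξ, exp (-(v * ‖ξ‖ ^ 2)) * g ξ ≤
      C₁ * K ^ 2 * v ^ (-((n - b) / 2)) := fun v hv => by
    have hv0 : 0 < v := lt_of_lt_of_le (by positivity) hv
    rw [(integral_exp_mul_fourierSq hv0 G μ).2]
    have h1 : ∑ y ∈ G, μ y * ∑ y' ∈ G, μ y' * exp (-(‖y - y'‖ / (2 * √v)) ^ 2) ≤
        K * (K * (2 * √v) ^ b) := by
      have hδv : δ ≤ 2 * √v := by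
        have := le_sqrt_of_sq_le hv
        have := sqrt_nonneg v
        linarith
      calc _ ≤ ∑ y ∈ G, μ y * (K * (2 * √v) ^ b) := by
            gcongr with y hy
            · exact hμ y hy
            · exact hF _ hδv y hy
        _ ≤ _ := by
            rw [← Finset.sum_mul]
            gcongr
    calc _ ≤ (π / v) ^ ((n : ℝ) / 2) * (K * (K * (2 * √v) ^ b)) := by gcongr
      _ = _ := by
        rw [div_rpow pi_nonneg hv0.le, mul_rpow zero_le_two (sqrt_nonneg v), sqrt_eq_rpow,
          ← rpow_mul hv0.le, show -(((n : ℝ) - b) / 2) = 1 / 2 * b - n / 2 by ring,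
          rpow_sub hv0]
        ring
  have hmeas : AEMeasurable (Function.uncurry fun (ξ : V) (u : ℝ) =>
      ENNReal.ofReal (u ^ (a / 2 - 1) * exp (-(‖ξ‖ ^ 2 * u)) *
        (exp (-(δ ^ 2 * ‖ξ‖ ^ 2)) * g ξ))) (volume.prod (volume.restrict (Ioi 0))) := by
    have := hgc.measurable
    exact Measurable.aemeasurable (by unfold Function.uncurry; fun_prop)
  have hl : ∫⁻ ξ, ENNReal.ofReal (Gamma (a / 2) *
      (‖ξ‖ ^ (-a) * (exp (-(δ ^ 2 * ‖ξ‖ ^ 2)) * g ξ))) ≤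
      ENNReal.ofReal (C₁ * C₂ * K ^ 2 * δ ^ (a + b - n)) := by
    calc ∫⁻ ξ, ENNReal.ofReal (Gamma (a / 2) *
          (‖ξ‖ ^ (-a) * (exp (-(δ ^ 2 * ‖ξ‖ ^ 2)) * g ξ)))
        = ∫⁻ ξ, ∫⁻ u in Ioi (0 : ℝ), ENNReal.ofReal (u ^ (a / 2 - 1) * exp (-(‖ξ‖ ^ 2 * u)) *
          (exp (-(δ ^ 2 * ‖ξ‖ ^ 2)) * g ξ)) := by
          refine lintegral_congr_ae ?_
          filter_upwards [compl_mem_ae_iff.2 (measure_singleton (0 : V))] with ξ hξ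
          have hξ0 : 0 < ‖ξ‖ := norm_pos_iff.2 hξ
          have h0 : 0 ≤ exp (-(δ ^ 2 * ‖ξ‖ ^ 2)) * g ξ := mul_nonneg (exp_pos _).le (hg0 ξ)
          simp_rw [ENNReal.ofReal_mul' h0]
          rw [lintegral_mul_const' _ _ ENNReal.ofReal_ne_top,
            lintegral_rpow_mul_exp_neg_mul (by positivity) (by positivity),
            ← ENNReal.ofReal_mul' h0, ← rpow_natCast ‖ξ‖, ← rpow_mul hξ0.le]
          congr 1
          push_cast
          rw [show (2 : ℝ) * -(a / 2) = -a by ring]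
          ring
      _ = ∫⁻ u in Ioi (0 : ℝ), ∫⁻ ξ, ENNReal.ofReal (u ^ (a / 2 - 1) * exp (-(‖ξ‖ ^ 2 * u)) *
          (exp (-(δ ^ 2 * ‖ξ‖ ^ 2)) * g ξ)) := lintegral_lintegral_swap hmeas
      _ ≤ ∫⁻ u in Ioi (0 : ℝ), ENNReal.ofReal (C₁ * K ^ 2) *
          ENNReal.ofReal (u ^ (a / 2 - 1) * (u + δ ^ 2) ^ (-((n - b) / 2))) := by
          refine setLIntegral_mono' measurableSet_Ioi fun u hu => ?_
          have hu0 : 0 < u := hu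
          have h2 : ∀ ξ : V, u ^ (a / 2 - 1) * exp (-(‖ξ‖ ^ 2 * u)) *
              (exp (-(δ ^ 2 * ‖ξ‖ ^ 2)) * g ξ) =
              u ^ (a / 2 - 1) * (exp (-((u + δ ^ 2) * ‖ξ‖ ^ 2)) * g ξ) := fun ξ => by
            rw [show -((u + δ ^ 2) * ‖ξ‖ ^ 2) = -(‖ξ‖ ^ 2 * u) + -(δ ^ 2 * ‖ξ‖ ^ 2) by ring,
              exp_add]
            ring
          simp_rw [h2]
          rw [← ofReal_integral_eq_lintegral_ofReal
            ((integral_exp_mul_fourierSq (by positivity) G μ).1.const_mul _)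
            (.of_forall fun ξ => mul_nonneg (by positivity) (mul_nonneg (exp_pos _).le (hg0 ξ))),
            ← ENNReal.ofReal_mul (by positivity), integral_const_mul]
          refine ENNReal.ofReal_le_ofReal ?_
          calc _ ≤ u ^ (a / 2 - 1) * (C₁ * K ^ 2 * (u + δ ^ 2) ^ (-((n - b) / 2))) := by
                gcongr
                exact hgauss _ (by linarith)
            _ = _ := by ring
      _ ≤ ENNReal.ofReal (C₁ * K ^ 2) *
          ENNReal.ofReal (C₂ * (δ ^ 2) ^ (a / 2 - (n - b) / 2)) := by
          rw [lintegral_const_mul' _ _ ENNReal.ofReal_ne_top]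
          gcongr
          exact lintegral_rpow_mul_add_rpow_le (by positivity) (by linarith) (by positivity)
      _ = _ := by
          rw [← ENNReal.ofReal_mul (by positivity), ← rpow_natCast δ, ← rpow_mul hδ.le]
          congr 1
          push_cast
          rw [show (2 : ℝ) * (a / 2 - (n - b) / 2) = a + b - n by ring]
          ring
  have hnn : ∀ ξ, 0 ≤ Gamma (a / 2) * (‖ξ‖ ^ (-a) * (exp (-(δ ^ 2 * ‖ξ‖ ^ 2)) * g ξ)) := fun ξ =>
    mul_nonneg hΓ.le (mul_nonneg (by positivity) (mul_nonneg (exp_pos _).le (hg0 ξ)))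
  have h_integrable : Integrable fun ξ => Gamma (a / 2) *
      (‖ξ‖ ^ (-a) * (exp (-(δ ^ 2 * ‖ξ‖ ^ 2)) * g ξ)) := by
    refine ⟨Measurable.aestronglyMeasurable (by have := hgc.measurable; fun_prop), ?_⟩
    rw [hasFiniteIntegral_iff_ofReal (.of_forall hnn)]
    exact hl.trans_lt ENNReal.ofReal_lt_top
  rw [← ofReal_integral_eq_lintegral_ofReal h_integrable (.of_forall hnn),
    ENNReal.ofReal_le_ofReal_iff (by positivity), integral_const_mul] at hl
  refine ⟨?_, ?_⟩
  · simpa [hΓ.ne'] using h_integrable.const_mul (Gamma (a / 2))⁻¹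
  · rw [← inv_mul_cancel_left₀ hΓ.ne' (∫ ξ, _)]
    calc _ ≤ (Gamma (a / 2))⁻¹ * (C₁ * C₂ * K ^ 2 * δ ^ (a + b - n)) := by gcongr
      _ = _ := by ring

lemma exists_abs_sphereCos_le_rpow (hV : 2 ≤ finrank ℝ V) {s : ℝ} (hs0 : 0 ≤ s)
    (hs : s ≤ ((finrank ℝ V : ℝ) - 1) / 2) :
    ∃ C : ℝ, 0 < C ∧ ∀ ζ : V, ζ ≠ 0 → |sphereCos ζ| ≤ C * ‖ζ‖ ^ (-s) := by
  obtain ⟨C, hC, hS⟩ := exists_sphereCos_decay hV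
  set A := (volume : Measure V).toSphere.real univ
  have hA : 0 ≤ A := measureReal_nonneg
  refine ⟨√C + A, by positivity, fun ζ hζ => ?_⟩
  have hζ0 : 0 < ‖ζ‖ := norm_pos_iff.2 hζ
  rw [rpow_neg hζ0.le, ← div_eq_mul_inv, le_div_iff₀ (by positivity)]
  rcases le_total ‖ζ‖ 1 with h | h
  · calc |sphereCos ζ| * ‖ζ‖ ^ s ≤ A * 1 := by
          gcongr
          · exact abs_sphereCos_le ζ
          · exact rpow_le_one hζ0.le h hs0
      _ ≤ _ := by linarith [sqrt_nonneg C]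
  · have h1 : |sphereCos ζ| * ‖ζ‖ ^ s ≤ √C := by
      refine le_sqrt_of_sq_le ((le_trans ?_ (hS ζ)))
      rw [mul_pow, sq_abs, mul_comm]
      gcongr
      rw [← rpow_natCast, ← rpow_natCast, ← rpow_mul hζ0.le]
      refine rpow_le_rpow_of_exponent_le h ?_
      rw [Nat.cast_sub (by omega)]
      push_cast
      linarith
    linarith

lemma integral_rpow_mul_gauss {q δ : ℝ} (hq : -1 < q) (hδ : 0 < δ) :
    IntegrableOn (fun y : ℝ => y ^ q * exp (-(δ ^ 2 * y ^ 2))) (Ioi 0) ∧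
    ∫ y in Ioi (0 : ℝ), y ^ q * exp (-(δ ^ 2 * y ^ 2)) =
      Gamma ((q + 1) / 2) / 2 * δ ^ (-(q + 1)) := by
  have h1 := integrableOn_rpow_mul_exp_neg_mul_rpow (p := 2) hq two_pos
    (by positivity : 0 < δ ^ 2)
  have h2 := integral_rpow_mul_exp_neg_mul_rpow (p := 2) two_pos hq (by positivity : 0 < δ ^ 2)
  simp only [rpow_two, neg_mul] at h1 h2
  refine ⟨h1, h2.trans ?_⟩
  rw [← rpow_natCast, ← rpow_mul hδ.le]
  push_cast
  rw [show (2 : ℝ) * (-(q + 1) / 2) = -(q + 1) by ring]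
  ring

lemma integrable_rpow_norm_mul_gauss [Nontrivial V] {a δ : ℝ} (ha : 0 ≤ a) (hδ : 0 < δ) :
    Integrable fun ξ : V => ‖ξ‖ ^ a * exp (-(δ ^ 2 * ‖ξ‖ ^ 2)) := by
  rw [integrable_fun_norm_addHaar volume (f := fun y : ℝ => y ^ a * exp (-(δ ^ 2 * y ^ 2)))]
  have h := (integral_rpow_mul_gauss (q := (finrank ℝ V - 1 : ℕ) + a) (by
    have : (0 : ℝ) ≤ (finrank ℝ V - 1 : ℕ) := Nat.cast_nonneg _
    linarith) hδ).1
  refine h.congr_fun (fun y hy => ?_) measurableSet_Ioi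
  have : 0 < y := hy
  simp only [smul_eq_mul]
  rw [rpow_add this, rpow_natCast, mul_assoc]

lemma abs_sphereCos_kernel_le {g : ℝ} (u v : V) (t : ℝ) :
    |g * (sphereCos u * sphereCos v * cos t)| ≤
      (volume : Measure V).toSphere.real univ ^ 2 * |g| := by
  have h1 := abs_sphereCos_le u
  have h2 := abs_sphereCos_le v
  rw [abs_mul, abs_mul, abs_mul]
  calc |g| * (|sphereCos u| * |sphereCos v| * |cos t|) ≤
      |g| * ((volume : Measure V).toSphere.real univ * (volume : Measure V).toSphere.real univ
        * 1) := by
        gcongr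
        exact abs_cos_le_one _
    _ = _ := by ring

lemma integrable_sphereCos_kernel [Nontrivial V] {a δ : ℝ} (ha : 0 ≤ a) (hδ : 0 < δ) (r r' : ℝ)
    (z : V) : Integrable fun ξ : V => ‖ξ‖ ^ a * exp (-(δ ^ 2 * ‖ξ‖ ^ 2)) *
      (sphereCos (r • ξ) * sphereCos (r' • ξ) * cos ⟪z, ξ⟫) := by
  have h1 : Continuous (sphereCos : V → ℝ) := continuous_sphereCos
  have h2 : Continuous fun ξ : V => ‖ξ‖ ^ a := continuous_norm.rpow_const fun _ => Or.inr ha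
  refine ((integrable_rpow_norm_mul_gauss (V := V) ha hδ).const_mul
    ((volume : Measure V).toSphere.real univ ^ 2)).mono'
    (Continuous.aestronglyMeasurable (by fun_prop)) (.of_forall fun ξ => ?_)
  refine (abs_sphereCos_kernel_le _ _ _).trans (le_of_eq ?_)
  rw [abs_of_nonneg (by positivity)]

/-- The interaction between two spheres decays like a power of the distance of their centres. -/
lemma exists_sphereCos_kernel_le (hV : 2 ≤ finrank ℝ V) {a s r₀ : ℝ} (ha : 0 ≤ a) (hs0 : 0 ≤ s)
    (hs : s ≤ ((finrank ℝ V : ℝ) - 1) / 2) (has : s < a + 1) (hr₀ : 0 < r₀) :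
    ∃ C : ℝ, 0 < C ∧ ∀ (δ r r' : ℝ) (z : V), 0 < δ → r₀ ≤ r → r₀ ≤ r' →
      ∫ ξ : V, ‖ξ‖ ^ a * exp (-(δ ^ 2 * ‖ξ‖ ^ 2)) *
        (sphereCos (r • ξ) * sphereCos (r' • ξ) * cos ⟪z, ξ⟫) ≤
        C * δ ^ (-(a + 1 - s)) * max ‖z‖ δ ^ (-s) := by
  have : Nontrivial V := nontrivial_of_finrank_pos (R := ℝ) (by omega)
  obtain ⟨e, he⟩ := exists_norm_eq V zero_le_one
  obtain ⟨C₁, hC₁, h₁⟩ := exists_sphereCos_decay hV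
  obtain ⟨C₂, hC₂, h₂⟩ := exists_abs_sphereCos_le_rpow hV hs0 hs
  set n := finrank ℝ V with hn
  set σ := (volume : Measure V).toSphere
  set A := σ.real univ
  have hA : 0 ≤ A := measureReal_nonneg
  set D := C₁ / r₀ ^ (n - 1)
  set Γ₁ := Gamma ((a - s + 1) / 2) / 2
  set Γ₂ := Gamma ((a + 1) / 2) / 2
  have hΓ₁ : 0 < Γ₁ := half_pos (Gamma_pos_of_pos (by linarith))
  have hΓ₂ : 0 < Γ₂ := half_pos (Gamma_pos_of_pos (by linarith))
  refine ⟨D * C₂ * Γ₁ + D * A * Γ₂, by positivity, fun δ r r' z hδ hr hr' => ?_⟩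
  have hSS : ∀ y : ℝ, 0 < y →
      y ^ (n - 1) * |sphereCos ((r * y) • e) * sphereCos ((r' * y) • e)| ≤ D := fun y hy => by
    have h3 : ∀ t, r₀ ≤ t → y ^ (n - 1) * sphereCos ((t * y) • e) ^ 2 ≤ D := fun t ht => by
      have ht0 : 0 < t := hr₀.trans_le ht
      rw [le_div_iff₀ (by positivity)]
      calc y ^ (n - 1) * sphereCos ((t * y) • e) ^ 2 * r₀ ^ (n - 1) ≤
            y ^ (n - 1) * sphereCos ((t * y) • e) ^ 2 * t ^ (n - 1) := by gcongr
        _ = ‖(t * y) • e‖ ^ (n - 1) * sphereCos ((t * y) • e) ^ 2 := by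
            rw [norm_smul, he, mul_one, norm_eq_abs, abs_of_pos (by positivity), mul_pow]
            ring
        _ ≤ C₁ := h₁ _
    have h4 := h3 r hr
    have h5 := h3 r' hr'
    have h6 : |sphereCos ((r * y) • e) * sphereCos ((r' * y) • e)| ≤
        (sphereCos ((r * y) • e) ^ 2 + sphereCos ((r' * y) • e) ^ 2) / 2 := by
      rw [abs_mul, ← sq_abs (sphereCos ((r * y) • e)), ← sq_abs (sphereCos ((r' * y) • e))]
      nlinarith [sq_nonneg (|sphereCos ((r * y) • e)| - |sphereCos ((r' * y) • e)|)]
    calc _ ≤ y ^ (n - 1) * ((sphereCos ((r * y) • e) ^ 2 + sphereCos ((r' * y) • e) ^ 2) / 2) := by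
          gcongr
      _ ≤ D := by linarith
  have hD : 0 < D := by positivity
  rw [integral_eq_integral_Ioi_sphere (integrable_sphereCos_kernel ha hδ r r' z)]
  have hpolar : ∀ y ∈ Ioi (0 : ℝ), y ^ (n - 1) * ∫ ω : sphere (0 : V) 1,
      ‖y • (ω : V)‖ ^ a * exp (-(δ ^ 2 * ‖y • (ω : V)‖ ^ 2)) * (sphereCos (r • y • (ω : V)) *
        sphereCos (r' • y • (ω : V)) * cos ⟪z, y • (ω : V)⟫) ∂σ =
      (y ^ (n - 1) * (sphereCos ((r * y) • e) * sphereCos ((r' * y) • e))) *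
        (y ^ a * exp (-(δ ^ 2 * y ^ 2))) * sphereCos (y • z) := fun y hy => by
    have hy0 : 0 < y := hy
    have h7 : ∀ ω : sphere (0 : V) 1, ‖y • (ω : V)‖ ^ a * exp (-(δ ^ 2 * ‖y • (ω : V)‖ ^ 2)) *
        (sphereCos (r • y • (ω : V)) * sphereCos (r' • y • (ω : V)) * cos ⟪z, y • (ω : V)⟫) =
        (sphereCos ((r * y) • e) * sphereCos ((r' * y) • e)) *
          (y ^ a * exp (-(δ ^ 2 * y ^ 2))) * cos ⟪y • z, (ω : V)⟫ := fun ω => by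
      rw [sphereCos_eq_of_norm_eq (ξ := r • y • (ω : V)) (η := (r * y) • e)
        (by simp [norm_smul, he]), sphereCos_eq_of_norm_eq (ξ := r' • y • (ω : V))
        (η := (r' * y) • e) (by simp [norm_smul, he]), real_inner_smul_right,
        real_inner_smul_left, norm_smul, norm_eq_of_mem_sphere, mul_one, norm_eq_abs,
        abs_of_pos hy0]
      ring
    simp_rw [h7]
    rw [integral_const_mul, show ∫ ω : sphere (0 : V) 1, cos ⟪y • z, (ω : V)⟫ ∂σ =
      sphereCos (y • z) from rfl]
    ring
  rw [setIntegral_congr_fun measurableSet_Ioi hpolar]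
  have hbound : ∀ {q B : ℝ}, -1 < q → (∀ y, 0 < y → y ^ a * |sphereCos (y • z)| ≤ B * y ^ q) →
      ∫ y in Ioi (0 : ℝ), (y ^ (n - 1) * (sphereCos ((r * y) • e) * sphereCos ((r' * y) • e))) *
        (y ^ a * exp (-(δ ^ 2 * y ^ 2))) * sphereCos (y • z) ≤
      D * B * (Gamma ((q + 1) / 2) / 2 * δ ^ (-(q + 1))) := fun {q B} hq hB => by
    obtain ⟨hi, he⟩ := integral_rpow_mul_gauss hq hδ
    rw [← he, ← integral_const_mul]
    refine (le_abs_self _).trans ?_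
    rw [← norm_eq_abs]
    refine norm_integral_le_of_norm_le (hi.const_mul (D * B)) ?_
    filter_upwards [ae_restrict_mem measurableSet_Ioi] with y hy
    have hy0 : 0 < y := hy
    rw [norm_eq_abs, abs_mul, abs_mul, abs_mul (y ^ (n - 1)), abs_of_pos (by positivity),
      abs_of_pos (a := y ^ a * _) (by positivity)]
    calc _ = (y ^ (n - 1) * |sphereCos ((r * y) • e) * sphereCos ((r' * y) • e)|) *
          (y ^ a * |sphereCos (y • z)|) * exp (-(δ ^ 2 * y ^ 2)) := by ring
      _ ≤ D * (B * y ^ q) * exp (-(δ ^ 2 * y ^ 2)) := by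
          gcongr ?_ * ?_ * _
          · exact hSS y hy0
          · exact hB y hy0
      _ = _ := by ring
  rcases le_total δ ‖z‖ with hz | hz
  · rw [max_eq_left hz]
    have hz0 : 0 < ‖z‖ := hδ.trans_le hz
    refine (hbound (q := a - s) (B := C₂ * ‖z‖ ^ (-s)) (by linarith) fun y hy => ?_).trans ?_
    · have h8 := h₂ (y • z) (smul_ne_zero hy.ne' (norm_pos_iff.1 hz0))
      rw [norm_smul, norm_eq_abs, abs_of_pos hy, mul_rpow hy.le hz0.le] at h8
      calc y ^ a * |sphereCos (y • z)| ≤ y ^ a * (C₂ * (y ^ (-s) * ‖z‖ ^ (-s))) := by gcongr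
        _ = _ := by
          rw [sub_eq_add_neg, rpow_add hy]
          ring
    · rw [show -(a - s + 1) = -(a + 1 - s) by ring]
      have : 0 ≤ D * A * Γ₂ * δ ^ (-(a + 1 - s)) * ‖z‖ ^ (-s) := by positivity
      linear_combination this
  · rw [max_eq_right hz]
    refine (hbound (q := a) (B := A) (by linarith) fun y hy => ?_).trans ?_
    · rw [mul_comm]
      gcongr
      exact abs_sphereCos_le _
    · have h9 : δ ^ (-(a + 1)) = δ ^ (-(a + 1 - s)) * δ ^ (-s) := by
        rw [← rpow_add hδ]
        congr 1
        ring
      rw [h9]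
      have : 0 ≤ D * C₂ * Γ₁ * δ ^ (-(a + 1 - s)) * δ ^ (-s) := by positivity
      linear_combination this

/-- The squared modulus of the Fourier transform of a finite combination of spheres. -/
noncomputable def spheresSq {ι : Type*} (I : Finset ι) (w r : ι → ℝ) (x : ι → V) (ξ : V) : ℝ :=
  (∑ i ∈ I, w i * sphereCos (r i • ξ) * cos ⟪x i, ξ⟫) ^ 2 +
    (∑ i ∈ I, w i * sphereCos (r i • ξ) * sin ⟪x i, ξ⟫) ^ 2

lemma integral_spheresSq [Nontrivial V] {a δ : ℝ} (ha : 0 ≤ a) (hδ : 0 < δ) {ι : Type*}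
    (I : Finset ι) (w r : ι → ℝ) (x : ι → V) :
    Integrable (fun ξ => ‖ξ‖ ^ a * exp (-(δ ^ 2 * ‖ξ‖ ^ 2)) * spheresSq I w r x ξ) ∧
    ∫ ξ, ‖ξ‖ ^ a * exp (-(δ ^ 2 * ‖ξ‖ ^ 2)) * spheresSq I w r x ξ =
      ∑ i ∈ I, ∑ j ∈ I, w i * w j * ∫ ξ : V, ‖ξ‖ ^ a * exp (-(δ ^ 2 * ‖ξ‖ ^ 2)) *
        (sphereCos (r i • ξ) * sphereCos (r j • ξ) * cos ⟪x i - x j, ξ⟫) := by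
  have hi : ∀ i j, Integrable (fun ξ : V => w i * w j * (‖ξ‖ ^ a * exp (-(δ ^ 2 * ‖ξ‖ ^ 2)) *
        (sphereCos (r i • ξ) * sphereCos (r j • ξ) * cos ⟪x i - x j, ξ⟫))) := fun i j =>
    (integrable_sphereCos_kernel ha hδ (r i) (r j) (x i - x j)).const_mul _
  have h : ∀ ξ, ‖ξ‖ ^ a * exp (-(δ ^ 2 * ‖ξ‖ ^ 2)) * spheresSq I w r x ξ =
      ∑ i ∈ I, ∑ j ∈ I, w i * w j * (‖ξ‖ ^ a * exp (-(δ ^ 2 * ‖ξ‖ ^ 2)) *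
        (sphereCos (r i • ξ) * sphereCos (r j • ξ) * cos ⟪x i - x j, ξ⟫)) := fun ξ => by
    rw [spheresSq, sq_sum_cos_add_sq_sum_sin, Finset.mul_sum]
    refine Finset.sum_congr rfl fun i _ => ?_
    rw [Finset.mul_sum]
    refine Finset.sum_congr rfl fun j _ => ?_
    rw [inner_sub_left]
    ring
  simp_rw [h]
  refine ⟨integrable_finsetSum _ fun i _ => integrable_finsetSum _ fun j _ => hi i j, ?_⟩
  rw [integral_finsetSum _ fun i _ => integrable_finsetSum _ fun j _ => hi i j]
  refine Finset.sum_congr rfl fun i _ => ?_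
  rw [integral_finsetSum _ fun j _ => hi i j]
  exact Finset.sum_congr rfl fun j _ => integral_const_mul _ _

lemma integral_cross_le [Nontrivial V] {a δ κ : ℝ} (ha : 0 ≤ a) (hδ : 0 < δ) (hκ : 0 < κ)
    {ι : Type*} (I : Finset ι) (w r : ι → ℝ) (x : ι → V) (G : Finset V) (μ : V → ℝ)
    (hG : Integrable fun ξ => ‖ξ‖ ^ (-a) * (exp (-(δ ^ 2 * ‖ξ‖ ^ 2)) * fourierSq G μ ξ)) :
    ∑ i ∈ I, w i * ∑ y ∈ G, μ y * ∫ ξ : V, exp (-(δ ^ 2 * ‖ξ‖ ^ 2)) *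
        (sphereCos (r i • ξ) * cos ⟪x i - y, ξ⟫) ≤
      κ * (∫ ξ, ‖ξ‖ ^ a * exp (-(δ ^ 2 * ‖ξ‖ ^ 2)) * spheresSq I w r x ξ) +
      κ⁻¹ * ∫ ξ, ‖ξ‖ ^ (-a) * (exp (-(δ ^ 2 * ‖ξ‖ ^ 2)) * fourierSq G μ ξ) := by
  have hgauss : Integrable fun ξ : V => exp (-(δ ^ 2 * ‖ξ‖ ^ 2)) :=
    integrable_exp_neg_mul_sq_norm (by positivity)
  have hi : ∀ i y, Integrable (fun ξ : V => w i * (μ y * (exp (-(δ ^ 2 * ‖ξ‖ ^ 2)) *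
        (sphereCos (r i • ξ) * cos ⟪x i - y, ξ⟫)))) := fun i y => by
    have h1 : Continuous (sphereCos : V → ℝ) := continuous_sphereCos
    refine (((hgauss.const_mul ((volume : Measure V).toSphere.real univ)).mono'
      (Continuous.aestronglyMeasurable (by fun_prop)) (.of_forall fun ξ => ?_)).const_mul
      (μ y)).const_mul (w i)
    rw [← mul_assoc, norm_eq_abs]
    refine (abs_mul_cos_le _).trans ?_
    rw [abs_mul, abs_of_pos (exp_pos _), mul_comm]
    gcongr
    exact abs_sphereCos_le _
  have hsum : ∑ i ∈ I, w i * ∑ y ∈ G, μ y * ∫ ξ : V, exp (-(δ ^ 2 * ‖ξ‖ ^ 2)) *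
        (sphereCos (r i • ξ) * cos ⟪x i - y, ξ⟫) =
      ∫ ξ : V, ∑ i ∈ I, ∑ y ∈ G, w i * (μ y * (exp (-(δ ^ 2 * ‖ξ‖ ^ 2)) *
        (sphereCos (r i • ξ) * cos ⟪x i - y, ξ⟫))) := by
    rw [integral_finsetSum _ fun i _ => integrable_finsetSum _ fun y _ => hi i y]
    refine Finset.sum_congr rfl fun i _ => ?_
    rw [integral_finsetSum _ fun y _ => hi i y, Finset.mul_sum]
    refine Finset.sum_congr rfl fun y _ => ?_
    rw [integral_const_mul, integral_const_mul]
  have hP := (integral_spheresSq ha hδ I w r x).1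
  rw [hsum, ← integral_const_mul, ← integral_const_mul,
    ← integral_add (hP.const_mul κ) (hG.const_mul κ⁻¹)]
  refine integral_mono_ae
    (integrable_finsetSum _ fun i _ => integrable_finsetSum _ fun y _ => hi i y)
    ((hP.const_mul κ).add (hG.const_mul κ⁻¹)) ?_
  filter_upwards [compl_mem_ae_iff.2 (measure_singleton (0 : V))] with ξ hξ
  have hξ0 : 0 < ‖ξ‖ := norm_pos_iff.2 hξ
  set f₁ := ∑ i ∈ I, w i * sphereCos (r i • ξ) * cos ⟪x i, ξ⟫ with hf₁
  set f₂ := ∑ i ∈ I, w i * sphereCos (r i • ξ) * sin ⟪x i, ξ⟫ with hf₂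
  set m₁ := ∑ y ∈ G, μ y * cos ⟪y, ξ⟫ with hm₁
  set m₂ := ∑ y ∈ G, μ y * sin ⟪y, ξ⟫ with hm₂
  have hprod : ∑ i ∈ I, ∑ y ∈ G, w i * (μ y * (exp (-(δ ^ 2 * ‖ξ‖ ^ 2)) *
        (sphereCos (r i • ξ) * cos ⟪x i - y, ξ⟫))) =
      exp (-(δ ^ 2 * ‖ξ‖ ^ 2)) * (f₁ * m₁ + f₂ * m₂) := by
    rw [hf₁, hf₂, hm₁, hm₂, Finset.sum_mul_sum, Finset.sum_mul_sum, ← Finset.sum_add_distrib,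
      Finset.mul_sum]
    refine Finset.sum_congr rfl fun i _ => ?_
    rw [← Finset.sum_add_distrib, Finset.mul_sum]
    refine Finset.sum_congr rfl fun y _ => ?_
    rw [inner_sub_left, cos_sub]
    ring
  rw [hprod]
  have hA : 0 < κ * ‖ξ‖ ^ a := by positivity
  have hAM : ∀ f m : ℝ, f * m ≤ κ * ‖ξ‖ ^ a * f ^ 2 + (κ * ‖ξ‖ ^ a)⁻¹ * m ^ 2 := fun f m => by
    set A := κ * ‖ξ‖ ^ a
    have h3 : A * f ^ 2 + A⁻¹ * m ^ 2 - 2 * (f * m) = A * (f - A⁻¹ * m) ^ 2 := by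
      field_simp
      ring
    have h4 : 0 ≤ A * (f - A⁻¹ * m) ^ 2 := by positivity
    have h5 : 0 ≤ A * f ^ 2 + A⁻¹ * m ^ 2 := by positivity
    linarith
  have h1 := mul_le_mul_of_nonneg_left (add_le_add (hAM f₁ m₁) (hAM f₂ m₂))
    (exp_pos (-(δ ^ 2 * ‖ξ‖ ^ 2))).le
  refine h1.trans (le_of_eq ?_)
  simp only [spheresSq, fourierSq, ← hf₁, ← hf₂, ← hm₁, ← hm₂]
  rw [rpow_neg hξ0.le, mul_inv]
  ring

/-- Incidences between points of `G` and spheres centred at points of `F`. -/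
lemma exists_incidence_le (hV : 2 ≤ finrank ℝ V) {a b s r₀ : ℝ} (r₁ τ : ℝ) (ha : 0 < a)
    (hab : a + b < finrank ℝ V) (hs0 : 0 ≤ s) (hs : s ≤ ((finrank ℝ V : ℝ) - 1) / 2)
    (has : s < a + 1) (hr₀ : 0 < r₀) :
    ∃ C : ℝ, 0 < C ∧ ∀ (δ K : ℝ) (F G : Finset V) (ν μ : V → ℝ) (R : V → Finset ℝ),
      0 < δ → δ ≤ 1 → 0 ≤ K → (∀ x ∈ F, 0 ≤ ν x) → (∀ y ∈ G, 0 ≤ μ y) →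
      (∀ x ∈ F, ∑ x' ∈ F, ν x' * max ‖x - x'‖ δ ^ (-s) ≤ K) → ∑ x ∈ F, ν x ≤ K →
      (∀ t, δ ≤ t → ∀ y ∈ G, ∑ y' ∈ G, μ y' * exp (-(‖y - y'‖ / t) ^ 2) ≤ K * t ^ b) →
      ∑ y ∈ G, μ y ≤ K → (∀ x ∈ F, ∀ r ∈ R x, r₀ ≤ r ∧ r ≤ r₁) →
      (∀ x ∈ F, ((R x).card : ℝ) ≤ δ ^ (-τ)) →
      ∑ x ∈ F, ν x * ∑ r ∈ R x, ∑ y ∈ G with |‖x - y‖ - r| ≤ δ, μ y ≤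
        C * K ^ 2 * δ ^ ((s + b - (finrank ℝ V - 1) - 2 * τ) / 2) := by
  have : Nontrivial V := nontrivial_of_finrank_pos (R := ℝ) (by omega)
  obtain ⟨c, hc, hlow⟩ := exists_integral_gauss_sphereCos_ge (V := V) r₁
  obtain ⟨C₁, hC₁, hker⟩ := exists_sphereCos_kernel_le hV ha.le hs0 hs has hr₀
  obtain ⟨C₂, hC₂, hen⟩ := exists_energy_le (V := V) ha hab
  set n := finrank ℝ V with hn
  refine ⟨c⁻¹ * (C₁ + C₂), by positivity,
    fun δ K F G ν μ R hδ hδ1 hK hν hμ hν1 hν2 hμ1 hμ2 hR hRc => ?_⟩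
  obtain ⟨hGi, hGe⟩ := hen δ K G μ hδ hK hμ hμ1 hμ2
  set I := F.sigma R
  set w : (Σ _ : V, ℝ) → ℝ := fun i => ν i.1
  set κ := δ ^ ((2 * a + b - n + 1 - s + 2 * τ) / 2)
  have hκ : 0 < κ := by positivity
  have hcross := integral_cross_le ha.le hδ hκ I w (fun i => i.2) (fun i => i.1) G μ hGi
  have hw : ∀ i ∈ I, 0 ≤ w i := fun i hi => hν _ (Finset.mem_sigma.1 hi).1
  have hP : ∫ ξ, ‖ξ‖ ^ a * exp (-(δ ^ 2 * ‖ξ‖ ^ 2)) *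
      spheresSq I w (fun i => i.2) (fun i => i.1) ξ ≤
      C₁ * K ^ 2 * δ ^ (-(a + 1 - s) - 2 * τ) := by
    rw [(integral_spheresSq ha.le hδ I w (fun i => i.2) (fun i => i.1)).2]
    calc _ ≤ ∑ i ∈ I, ∑ j ∈ I, w i * w j *
          (C₁ * δ ^ (-(a + 1 - s)) * max ‖i.1 - j.1‖ δ ^ (-s)) := by
          gcongr with i hi j hj
          · exact mul_nonneg (hw i hi) (hw j hj)
          · exact hker δ i.2 j.2 _ hδ (hR _ (Finset.mem_sigma.1 hi).1 _ (Finset.mem_sigma.1 hi).2).1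
              (hR _ (Finset.mem_sigma.1 hj).1 _ (Finset.mem_sigma.1 hj).2).1
      _ = C₁ * δ ^ (-(a + 1 - s)) * ∑ x ∈ F, ((R x).card : ℝ) * (ν x * ∑ x' ∈ F,
          ((R x').card : ℝ) * (ν x' * max ‖x - x'‖ δ ^ (-s))) := by
          simp only [I, w, Finset.sum_sigma, Finset.sum_const, nsmul_eq_mul, Finset.mul_sum]
          refine Finset.sum_congr rfl fun x _ => Finset.sum_congr rfl fun x' _ => ?_
          ring
      _ ≤ C₁ * δ ^ (-(a + 1 - s)) * ∑ x ∈ F, δ ^ (-τ) * (ν x * ∑ x' ∈ F,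
          δ ^ (-τ) * (ν x' * max ‖x - x'‖ δ ^ (-s))) := by
          have h1 : ∀ x ∈ F, ∀ x' ∈ F, 0 ≤ ν x' * max ‖x - x'‖ δ ^ (-s) := fun x _ x' hx' =>
            mul_nonneg (hν x' hx') (rpow_nonneg (le_max_of_le_right hδ.le) _)
          gcongr with x hx x' hx'
          · exact mul_nonneg (hν x hx) (Finset.sum_nonneg fun x' hx' =>
              mul_nonneg (Nat.cast_nonneg _) (h1 x hx x' hx'))
          · exact hRc x hx
          · exact hν x hx
          · exact h1 x hx x' hx'
          · exact hRc x' hx'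
      _ ≤ C₁ * δ ^ (-(a + 1 - s)) * ∑ x ∈ F, δ ^ (-τ) * (ν x * (δ ^ (-τ) * K)) := by
          gcongr with x hx
          · exact hν x hx
          · rw [← Finset.mul_sum]
            gcongr
            exact hν1 x hx
      _ = C₁ * δ ^ (-(a + 1 - s)) * (δ ^ (-τ) * δ ^ (-τ) * K * ∑ x ∈ F, ν x) := by
          congr 1
          rw [Finset.mul_sum]
          refine Finset.sum_congr rfl fun x _ => ?_
          ring
      _ ≤ C₁ * δ ^ (-(a + 1 - s)) * (δ ^ (-τ) * δ ^ (-τ) * K * K) := by gcongr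
      _ = _ := by
          rw [← rpow_add hδ, show -(a + 1 - s) - 2 * τ = -(a + 1 - s) + (-τ + -τ) by ring,
            rpow_add hδ (-(a + 1 - s))]
          ring
  set J := fun (x y : V) (r : ℝ) => ∫ ξ : V, exp (-(δ ^ 2 * ‖ξ‖ ^ 2)) *
        (sphereCos (r • ξ) * cos ⟪x - y, ξ⟫) with hJ
  have hLHS : ∑ x ∈ F, ν x * ∑ r ∈ R x, ∑ y ∈ G with |‖x - y‖ - r| ≤ δ, μ y ≤
      c⁻¹ * δ * ∑ i ∈ I, w i * ∑ y ∈ G, μ y * J i.1 y i.2 := by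
    simp only [I, w, Finset.sum_sigma]
    rw [Finset.mul_sum]
    refine Finset.sum_le_sum fun x hx => ?_
    rw [← Finset.mul_sum, mul_left_comm]
    refine mul_le_mul_of_nonneg_left ?_ (hν x hx)
    rw [Finset.mul_sum]
    refine Finset.sum_le_sum fun r hr => ?_
    rw [Finset.sum_filter, Finset.mul_sum]
    refine Finset.sum_le_sum fun y hy => ?_
    obtain ⟨hr0, hr1⟩ := hR x hx r hr
    obtain ⟨hJ0, hJ1⟩ := hlow δ r (x - y) hδ
    split_ifs with h
    · have h2 := hJ1 hδ1 (hr₀.le.trans hr0) hr1 h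
      calc μ y = c⁻¹ * δ * (μ y * (c * δ⁻¹)) := by field_simp
        _ ≤ _ := by
          have := hμ y hy
          gcongr
    · exact mul_nonneg (by positivity) (mul_nonneg (hμ y hy) hJ0)
  calc _ ≤ c⁻¹ * δ * (κ * (C₁ * K ^ 2 * δ ^ (-(a + 1 - s) - 2 * τ)) +
        κ⁻¹ * (C₂ * K ^ 2 * δ ^ (a + b - n))) := by
        refine hLHS.trans ?_
        gcongr
        refine hcross.trans ?_
        gcongr
    _ = _ := by
        have h1 : δ * (κ * δ ^ (-(a + 1 - s) - 2 * τ)) =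
            δ ^ ((s + b - (n - 1) - 2 * τ) / 2) := by
          simp only [κ]
          rw [← rpow_add hδ, mul_comm, ← rpow_add_one hδ.ne']
          congr 1
          ring
        have h2 : δ * (κ⁻¹ * δ ^ (a + b - n)) = δ ^ ((s + b - (n - 1) - 2 * τ) / 2) := by
          simp only [κ]
          rw [← rpow_neg hδ.le, ← rpow_add hδ, mul_comm, ← rpow_add_one hδ.ne']
          congr 1
          ring
        linear_combination c⁻¹ * C₁ * K ^ 2 * h1 + c⁻¹ * C₂ * K ^ 2 * h2

end Fourier

section Frostman

lemma exists_weights_saturated {X ι : Type*} [DecidableEq ι] (q : ℕ → X → ι) (w : ℕ → ℝ)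
    (hw : ∀ j, 0 ≤ w j) (n : ℕ) (F : Finset X) :
    ∃ ν : X → ℝ, (∀ x, 0 ≤ ν x) ∧
      (∀ j ≤ n, ∀ c, ∑ x ∈ F with q j x = c, ν x ≤ w j) ∧
      ∀ x ∈ F, ∃ j ≤ n, ∑ y ∈ F with q j y = q j x, ν y = w j := by
  classical
  induction F using Finset.induction_on with
  | empty => exact ⟨fun _ => 0, by simp, by simpa using fun j _ _ => hw j, by simp⟩
  | insert a F ha ih =>
    obtain ⟨ν, h0, hle, hsat⟩ := ih
    obtain ⟨i, hi, hmin⟩ := Finset.exists_min_image (Finset.range (n + 1))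
      (fun j => w j - ∑ y ∈ F with q j y = q j a, ν y) ⟨0, by simp⟩
    set v := w i - ∑ y ∈ F with q i y = q i a, ν y with hv
    have hi' : i ≤ n := by simpa [Nat.lt_succ_iff] using hi
    have hv0 : 0 ≤ v := sub_nonneg.2 (hle i hi' _)
    have hsum : ∀ j c, ∑ x ∈ insert a F with q j x = c, Function.update ν a v x =
        (if q j a = c then v else 0) + ∑ x ∈ F with q j x = c, ν x := by
      intro j c
      have h2 : ∀ x ∈ F.filter (fun x => q j x = c), Function.update ν a v x = ν x := by
        intro x hx
        rw [Function.update_of_ne]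
        rintro rfl
        exact ha (Finset.mem_filter.1 hx).1
      rw [Finset.filter_insert]
      split_ifs with h
      · rw [Finset.sum_insert (by simp [ha]), Finset.sum_congr rfl h2]
        simp
      · rw [Finset.sum_congr rfl h2, zero_add]
    have hle' : ∀ j ≤ n, ∀ c,
        ∑ x ∈ insert a F with q j x = c, Function.update ν a v x ≤ w j := by
      intro j hj c
      rw [hsum]
      split_ifs with h
      · have := hmin j (by simpa [Nat.lt_succ_iff] using hj)
        subst h
        linarith
      · simpa using hle j hj c
    refine ⟨Function.update ν a v, fun x => ?_, hle', fun x hx => ?_⟩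
    · by_cases h : x = a
      · simpa [h] using hv0
      · simpa [h] using h0 x
    · rcases Finset.mem_insert.1 hx with rfl | hx
      · refine ⟨i, hi', ?_⟩
        rw [hsum, if_pos rfl, hv]
        ring
      · obtain ⟨j, hj, h⟩ := hsat x hx
        refine ⟨j, hj, le_antisymm (hle' j hj _) ?_⟩
        rw [hsum, h]
        split_ifs <;> linarith

/-- Discrete form of Frostman's lemma: a set carries a finitely supported weight obeying the
prescribed upper bounds on all cells up to level `n`, whose total mass is the total cost of some
covering by cells. -/
lemma exists_frostman_weights {X ι : Type*} [DecidableEq ι] (q : ℕ → X → ι)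
    (hq : ∀ i j x y, i ≤ j → q j x = q j y → q i x = q i y) (w : ℕ → ℝ)
    (hw : ∀ j, 0 ≤ w j) (n : ℕ) {B : Set X} (hB : (q n '' B).Finite) :
    ∃ (F : Finset X) (ν : X → ℝ) (U : Finset (ℕ × ι)), ↑F ⊆ B ∧ (∀ x, 0 ≤ ν x) ∧
      (∀ j ≤ n, ∀ c, ∑ x ∈ F with q j x = c, ν x ≤ w j) ∧
      (∀ b ∈ B, ∃ u ∈ U, q u.1 b = u.2) ∧ ∑ u ∈ U, w u.1 = ∑ x ∈ F, ν x := by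
  classical
  obtain ⟨F, hFB, hF⟩ : ∃ F : Finset X, ↑F ⊆ B ∧ ∀ b ∈ B, ∃ x ∈ F, q n b = q n x := by
    obtain ⟨F, hFB, h⟩ := (Finset.subset_set_image_iff (t := hB.toFinset) (s := B)
      (f := q n)).1 (by simp)
    refine ⟨F, hFB, fun b hb => ?_⟩
    have : q n b ∈ Finset.image (q n) F := by
      rw [h]; simpa using ⟨b, hb, rfl⟩
    obtain ⟨x, hx, hxb⟩ := Finset.mem_image.1 this
    exact ⟨x, hx, hxb.symm⟩
  obtain ⟨ν, h0, hle, hsat⟩ := exists_weights_saturated q w hw n F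
  have hex : ∀ x : X, ∃ j, x ∈ F → (j ≤ n ∧ ∑ y ∈ F with q j y = q j x, ν y = w j) ∧
      ∀ i < j, ¬ (i ≤ n ∧ ∑ y ∈ F with q i y = q i x, ν y = w i) := by
    intro x
    by_cases hx : x ∈ F
    · have h := hsat x hx
      exact ⟨Nat.find h, fun _ => ⟨Nat.find_spec h, fun i hi => Nat.find_min h hi⟩⟩
    · exact ⟨0, fun h => absurd h hx⟩
  choose l hl using hex
  refine ⟨F, ν, F.image (fun x => (l x, q (l x) x)), hFB, h0, hle, fun b hb => ?_, ?_⟩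
  · obtain ⟨x, hx, hbx⟩ := hF b hb
    exact ⟨_, Finset.mem_image_of_mem _ hx, hq _ _ _ _ (hl x hx).1.1 hbx⟩
  · rw [← Finset.sum_fiberwise_of_maps_to (s := F)
      (fun x hx => Finset.mem_image_of_mem (fun x => (l x, q (l x) x)) hx)]
    refine Finset.sum_congr rfl fun u hu => ?_
    obtain ⟨x, hx, rfl⟩ := Finset.mem_image.1 hu
    rw [← (hl x hx).1.2]
    refine Finset.sum_congr (Finset.filter_congr fun y hy => ?_) fun _ _ => rfl
    constructor
    · intro h
      have h1 : l y ≤ l x := by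
        by_contra! hlt
        refine (hl y hy).2 _ hlt ⟨(hl x hx).1.1, ?_⟩
        rw [h]
        exact (hl x hx).1.2
      have h2 : l x ≤ l y := by
        by_contra! hlt
        refine (hl x hx).2 _ hlt ⟨(hl y hy).1.1, ?_⟩
        rw [← hq _ _ _ _ h1 h]
        exact (hl y hy).1.2
      have h3 := le_antisymm h1 h2
      simp [h3, h]
    · intro h
      have h1 := congrArg Prod.fst h
      have h2 := congrArg Prod.snd h
      simp only at h1 h2
      rw [h1] at h2
      exact h2

end Frostman

section Dyadic

open Set Real MeasureTheory Filter Topology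

variable {d : ℕ}

/-- The index of the half-open dyadic cube of side `2⁻¹ ^ k` containing `x`. -/
noncomputable def dyadicCell (k : ℕ) (x : EuclideanSpace ℝ (Fin d)) : Fin d → ℤ :=
  fun i => ⌊2 ^ k * x i⌋

lemma dyadicCell_eq_of_le {i j : ℕ} {x y : EuclideanSpace ℝ (Fin d)} (hij : i ≤ j)
    (h : dyadicCell j x = dyadicCell j y) : dyadicCell i x = dyadicCell i y := by
  obtain ⟨n, rfl⟩ := Nat.exists_eq_add_of_le hij
  have key : ∀ t : ℝ, ⌊2 ^ i * t⌋ = ⌊2 ^ (i + n) * t⌋ / ((2 ^ n : ℕ) : ℤ) := by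
    intro t
    rw [← Int.floor_div_natCast]
    congr 1
    push_cast
    field_simp
    ring
  funext l
  have := congrFun h l
  simp only [dyadicCell] at this ⊢
  rw [key, key, this]

lemma dist_le_of_dyadicCell_eq {k : ℕ} {x y : EuclideanSpace ℝ (Fin d)}
    (h : dyadicCell k x = dyadicCell k y) : dist x y ≤ √d * 2⁻¹ ^ k := by
  have h1 : ∀ i, |x i - y i| ≤ 2⁻¹ ^ k := by
    intro i
    have h2 := Int.abs_sub_lt_one_of_floor_eq_floor (congrFun h i)
    rw [← mul_sub, abs_mul, abs_of_pos (by positivity)] at h2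
    rw [inv_pow, ← one_div, le_div_iff₀ (by positivity)]
    linarith
  rw [EuclideanSpace.dist_eq]
  apply Real.sqrt_le_iff.2
  refine ⟨by positivity, ?_⟩
  calc ∑ i, dist (x i) (y i) ^ 2 ≤ ∑ _i : Fin d, ((2⁻¹ : ℝ) ^ k) ^ 2 := by
        gcongr with i
        rw [Real.dist_eq]
        exact h1 i
    _ = _ := by
        rw [mul_pow, Real.sq_sqrt (by positivity)]
        simp

lemma dyadicCell_mem_Icc {k : ℕ} {x y : EuclideanSpace ℝ (Fin d)} (h : dist x y ≤ 2⁻¹ ^ k) :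
    dyadicCell k y ∈ Icc (fun i => dyadicCell k x i - 1) (fun i => dyadicCell k x i + 1) := by
  have h1 : ∀ i, |2 ^ k * x i - 2 ^ k * y i| ≤ 1 := by
    intro i
    have h2 : |x i - y i| ≤ 2⁻¹ ^ k :=
      le_trans (by simpa using PiLp.norm_apply_le (x - y) i) (by rwa [dist_eq_norm] at h)
    rw [← mul_sub, abs_mul, abs_of_pos (by positivity)]
    rwa [inv_pow, ← one_div, le_div_iff₀' (by positivity)] at h2
  constructor <;> intro i <;> have h2 := abs_le.1 (h1 i) <;> simp only [dyadicCell]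
  · rw [Int.le_floor]
    push_cast
    linarith [Int.floor_le (2 ^ k * x i)]
  · rw [← Int.lt_add_one_iff, Int.floor_lt]
    push_cast
    linarith [Int.lt_floor_add_one (2 ^ k * x i)]

lemma finite_image_dyadicCell {B : Set (EuclideanSpace ℝ (Fin d))} (hB : Bornology.IsBounded B)
    (k : ℕ) : (dyadicCell k '' B).Finite := by
  obtain ⟨L, hL⟩ := hB.exists_norm_le
  refine (Set.finite_Icc (fun _ : Fin d => ⌊-(2 ^ k * L)⌋) (fun _ => ⌊2 ^ k * L⌋)).subset ?_
  rintro _ ⟨x, hx, rfl⟩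
  have h1 : ∀ i, |x i| ≤ L := fun i => le_trans (by simpa using PiLp.norm_apply_le x i) (hL x hx)
  constructor <;> intro i <;> have h2 := abs_le.1 (h1 i) <;> apply Int.floor_mono
  · have := mul_le_mul_of_nonneg_left h2.1 (show (0:ℝ) ≤ 2 ^ k by positivity)
    linarith
  · exact mul_le_mul_of_nonneg_left h2.2 (by positivity)

/-- A set with dyadic coverings of arbitrarily small `s`-dimensional content is
`s`-dimensionally null. -/
lemma hausdorffMeasure_eq_zero_of_dyadic_cover {s : ℝ} (hs : 0 < s)
    {S : Set (EuclideanSpace ℝ (Fin d))}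
    (h : ∀ ε : ℝ, 0 < ε → ∃ U : ℕ → Finset (ℕ × (Fin d → ℤ)),
      (∀ x ∈ S, ∃ n, ∃ u ∈ U n, dyadicCell u.1 x = u.2) ∧
      ∑' n, ENNReal.ofReal (∑ u ∈ U n, ((2⁻¹ : ℝ) ^ u.1) ^ s) ≤ ENNReal.ofReal ε) :
    μH[s] S = 0 := by
  choose U hU hsum using fun N : ℕ => h (2⁻¹ ^ N) (by positivity)
  have hpow : Tendsto (fun N : ℕ => (2⁻¹ : ℝ) ^ N) atTop (𝓝 0) :=
    tendsto_pow_atTop_nhds_zero_of_lt_one (by norm_num) (by norm_num)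
  let t : ∀ N : ℕ, (Σ n, U N n) → Set (EuclideanSpace ℝ (Fin d)) :=
    fun N i => {x | dyadicCell i.2.1.1 x = i.2.1.2}
  have hdiam : ∀ N i, Metric.ediam (t N i) ≤ ENNReal.ofReal (√d * 2⁻¹ ^ i.2.1.1) := by
    intro N i
    refine Metric.ediam_le fun x hx y hy => ?_
    rw [edist_dist]
    exact ENNReal.ofReal_le_ofReal (dist_le_of_dyadicCell_eq (hx.trans hy.symm))
  have hw : ∀ N (i : Σ n, U N n), ((2⁻¹ : ℝ) ^ i.2.1.1) ^ s ≤ 2⁻¹ ^ N := by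
    intro N i
    have h1 : ENNReal.ofReal (((2⁻¹ : ℝ) ^ i.2.1.1) ^ s) ≤ ENNReal.ofReal (2⁻¹ ^ N) :=
      calc ENNReal.ofReal (((2⁻¹ : ℝ) ^ i.2.1.1) ^ s)
          ≤ ENNReal.ofReal (∑ u ∈ U N i.1, ((2⁻¹ : ℝ) ^ u.1) ^ s) :=
            ENNReal.ofReal_le_ofReal (Finset.single_le_sum
              (f := fun u : ℕ × (Fin d → ℤ) => ((2⁻¹ : ℝ) ^ u.1) ^ s)
              (fun u _ => by positivity) i.2.2)
        _ ≤ _ := ENNReal.le_tsum (f := fun n =>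
              ENNReal.ofReal (∑ u ∈ U N n, ((2⁻¹ : ℝ) ^ u.1) ^ s)) i.1
        _ ≤ _ := hsum N
    exact (ENNReal.ofReal_le_ofReal_iff (by positivity)).1 h1
  have hr : Tendsto (fun N : ℕ => ENNReal.ofReal (√d * ((2⁻¹ : ℝ) ^ N) ^ s⁻¹)) atTop (𝓝 0) := by
    rw [← ENNReal.ofReal_zero]
    refine ENNReal.tendsto_ofReal ?_
    have := (hpow.rpow_const (p := s⁻¹) (Or.inr (by positivity))).const_mul √d
    simpa [Real.zero_rpow (inv_ne_zero hs.ne')] using this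
  have hle : ∀ N, ∑' i, Metric.ediam (t N i) ^ s ≤ ENNReal.ofReal (√d ^ s * 2⁻¹ ^ N) := by
    intro N
    calc ∑' i, Metric.ediam (t N i) ^ s
        ≤ ∑' i : Σ n, U N n, ENNReal.ofReal (√d ^ s) *
            ENNReal.ofReal (((2⁻¹ : ℝ) ^ i.2.1.1) ^ s) := by
          refine ENNReal.tsum_le_tsum fun i => ?_
          rw [← ENNReal.ofReal_mul (by positivity), ← Real.mul_rpow (by positivity)
            (by positivity), ← ENNReal.ofReal_rpow_of_nonneg (by positivity) hs.le]
          exact ENNReal.rpow_le_rpow (hdiam N i) hs.le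
      _ = ENNReal.ofReal (√d ^ s) * ∑' n,
            ENNReal.ofReal (∑ u ∈ U N n, ((2⁻¹ : ℝ) ^ u.1) ^ s) := by
          rw [ENNReal.tsum_mul_left, ENNReal.tsum_sigma']
          congr 2
          funext n
          rw [Finset.tsum_subtype (U N n)
            (fun u : ℕ × (Fin d → ℤ) => ENNReal.ofReal (((2⁻¹ : ℝ) ^ u.1) ^ s)),
            ENNReal.ofReal_sum_of_nonneg fun u _ => by positivity]
      _ ≤ ENNReal.ofReal (√d ^ s) * ENNReal.ofReal (2⁻¹ ^ N) := by gcongr; exact hsum N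
      _ = _ := (ENNReal.ofReal_mul (by positivity)).symm
  have hlim : Tendsto (fun N : ℕ => ENNReal.ofReal (√d ^ s * 2⁻¹ ^ N)) atTop (𝓝 0) := by
    rw [← ENNReal.ofReal_zero]
    refine ENNReal.tendsto_ofReal ?_
    simpa using hpow.const_mul (√d ^ s)
  have hmain := Measure.hausdorffMeasure_le_liminf_tsum s S _ hr t
    (Eventually.of_forall fun N i => (hdiam N i).trans (ENNReal.ofReal_le_ofReal (by
      gcongr
      rw [Real.le_rpow_inv_iff_of_pos (by positivity) (by positivity) hs]
      exact hw N i)))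
    (Eventually.of_forall fun N x hx => by
      obtain ⟨n, u, hu, hx⟩ := hU N x hx
      exact mem_iUnion.2 ⟨⟨n, u, hu⟩, hx⟩)
  have h0 : liminf (fun N => ∑' i, Metric.ediam (t N i) ^ s) atTop = 0 :=
    (tendsto_of_tendsto_of_tendsto_of_le_of_le tendsto_const_nhds hlim
      (fun _ => zero_le) hle).liminf_eq
  rw [h0] at hmain
  exact le_antisymm hmain zero_le

end Dyadic

section Energy

open Set Real

lemma sum_ball_le_of_dyadicCell {d n : ℕ} {s N : ℝ} (hs : 0 ≤ s) (hN : 0 ≤ N)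
    {F : Finset (EuclideanSpace ℝ (Fin d))} {ν : EuclideanSpace ℝ (Fin d) → ℝ}
    (h0 : ∀ x, 0 ≤ ν x)
    (hν : ∀ j ≤ n, ∀ c, ∑ x ∈ F with dyadicCell j x = c, ν x ≤ ((2⁻¹ : ℝ) ^ j) ^ s)
    (htot : ∑ x ∈ F, ν x ≤ N) (x : EuclideanSpace ℝ (Fin d)) {r : ℝ} (hr : 2⁻¹ ^ n ≤ r) :
    ∑ y ∈ F with ‖x - y‖ ≤ r, ν y ≤ (3 ^ d * 2 ^ s + N) * r ^ s := by
  have hr0 : 0 < r := lt_of_lt_of_le (by positivity) hr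
  rcases le_or_gt r 1 with hr1 | hr1
  · obtain ⟨j, hj1, hj2⟩ := exists_nat_pow_near_of_lt_one hr0 hr1 (y := (2⁻¹ : ℝ))
      (by norm_num) (by norm_num)
    have hjn : j ≤ n := by
      by_contra! h
      exact absurd (hr.trans hj2) (not_le.2 (pow_lt_pow_right_of_lt_one₀ (by norm_num)
        (by norm_num) h))
    have hcells : ∑ y ∈ F with ‖x - y‖ ≤ r, ν y ≤ 3 ^ d * ((2⁻¹ : ℝ) ^ j) ^ s := by
      set I := Finset.Icc (fun i => dyadicCell j x i - 1) (fun i => dyadicCell j x i + 1) with hI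
      have hmaps : ∀ y ∈ F.filter (fun y => ‖x - y‖ ≤ r), dyadicCell j y ∈ I := by
        intro y hy
        rw [hI, Finset.mem_Icc]
        exact dyadicCell_mem_Icc
          (by rw [dist_eq_norm]; exact (Finset.mem_filter.1 hy).2.trans hj2)
      have hcard : (I.card : ℝ) = 3 ^ d := by
        rw [hI, Pi.card_Icc]
        simp only [Int.card_Icc]
        have : ∀ i, (dyadicCell j x i + 1 + 1 - (dyadicCell j x i - 1)).toNat = 3 := by
          intro i
          omega
        simp [this]
      rw [← Finset.sum_fiberwise_of_maps_to hmaps, ← hcard, ← nsmul_eq_mul]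
      refine Finset.sum_le_card_nsmul _ _ _ fun c _ => le_trans ?_ (hν j hjn c)
      refine Finset.sum_le_sum_of_subset_of_nonneg ?_ fun _ _ _ => h0 _
      intro y hy
      simp only [Finset.mem_filter] at hy ⊢
      exact ⟨hy.1.1, hy.2⟩
    have h2 : ((2⁻¹ : ℝ) ^ j) ^ s ≤ 2 ^ s * r ^ s := by
      rw [← mul_rpow (by norm_num) hr0.le]
      refine rpow_le_rpow (by positivity) ?_ hs
      rw [pow_succ] at hj1
      linarith
    calc _ ≤ _ := hcells
      _ ≤ 3 ^ d * (2 ^ s * r ^ s) := by gcongr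
      _ ≤ _ := by
        have : 0 ≤ N * r ^ s := by positivity
        linarith
  · have h1 : 1 ≤ r ^ s := one_le_rpow hr1.le hs
    calc ∑ y ∈ F with ‖x - y‖ ≤ r, ν y ≤ ∑ y ∈ F, ν y :=
          Finset.sum_le_sum_of_subset_of_nonneg (Finset.filter_subset _ _) fun _ _ _ => h0 _
      _ ≤ N * 1 := by simpa using htot
      _ ≤ N * r ^ s := by gcongr
      _ ≤ _ := by
        have : 0 ≤ (3:ℝ) ^ d * 2 ^ s * r ^ s := by positivity
        linarith

variable {V : Type*} [NormedAddCommGroup V]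

lemma max_rpow_neg_le {n : ℕ} {s t : ℝ} (hs : 0 ≤ s) :
    max t (2⁻¹ ^ n) ^ (-s) ≤
      1 + ∑ j ∈ Finset.range (n + 1), if t ≤ 2⁻¹ ^ j then ((2⁻¹ : ℝ) ^ (j + 1)) ^ (-s) else 0 := by
  set M := max t (2⁻¹ ^ n) with hM
  have hM0 : 0 < M := lt_max_of_lt_right (by positivity)
  have hsum : ∀ j ∈ Finset.range (n + 1),
      0 ≤ if t ≤ 2⁻¹ ^ j then ((2⁻¹ : ℝ) ^ (j + 1)) ^ (-s) else 0 := by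
    intro j _
    split_ifs <;> positivity
  rcases le_or_gt M 1 with h1 | h1
  · obtain ⟨j, hj1, hj2⟩ := exists_nat_pow_near_of_lt_one hM0 h1 (y := (2⁻¹ : ℝ))
      (by norm_num) (by norm_num)
    have hjn : j ≤ n := by
      by_contra! h
      exact absurd ((le_max_right t _).trans hj2) (not_le.2 (pow_lt_pow_right_of_lt_one₀
        (by norm_num) (by norm_num) h))
    have h2 := Finset.single_le_sum hsum (Finset.mem_range.2 (Nat.lt_succ_of_le hjn))
    rw [if_pos ((le_max_left _ _).trans hj2)] at h2
    have h3 : M ^ (-s) ≤ ((2⁻¹ : ℝ) ^ (j + 1)) ^ (-s) :=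
      rpow_le_rpow_of_nonpos (by positivity) hj1.le (by linarith)
    linarith
  · have := Finset.sum_nonneg hsum
    have := rpow_le_one_of_one_le_of_nonpos h1.le (show -s ≤ 0 by linarith)
    linarith

lemma sum_rpow_neg_le {n : ℕ} {s s' C : ℝ} (hs' : 0 ≤ s') (hss : s' < s) (hC : 0 ≤ C)
    {F : Finset V} {ν : V → ℝ} (htot : ∑ x ∈ F, ν x ≤ C) (x : V)
    (hν : ∀ r, 2⁻¹ ^ n ≤ r → ∑ y ∈ F with ‖x - y‖ ≤ r, ν y ≤ C * r ^ s) (h0 : ∀ x, 0 ≤ ν x) :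
    ∑ y ∈ F, ν y * max ‖x - y‖ (2⁻¹ ^ n) ^ (-s') ≤
      C * (1 + 2 ^ s' * (1 - 2⁻¹ ^ (s - s'))⁻¹) := by
  have hq0 : (0 : ℝ) ≤ 2⁻¹ ^ (s - s') := by positivity
  have hq1 : (2⁻¹ : ℝ) ^ (s - s') < 1 := rpow_lt_one (by norm_num) (by norm_num) (by linarith)
  have hterm : ∀ j : ℕ, ((2⁻¹ : ℝ) ^ (j + 1)) ^ (-s') * (C * (2⁻¹ ^ j) ^ s) =
      C * 2 ^ s' * ((2⁻¹ : ℝ) ^ (s - s')) ^ j := by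
    intro j
    have e1 : ((2⁻¹ : ℝ) ^ (s - s')) ^ j = ((2⁻¹ : ℝ) ^ j) ^ s * ((2⁻¹ : ℝ) ^ j) ^ (-s') := by
      rw [← rpow_add (by positivity), ← sub_eq_add_neg, ← rpow_natCast, ← rpow_natCast,
        ← rpow_mul (by positivity), ← rpow_mul (by positivity), mul_comm]
    have e2 : ((2⁻¹ : ℝ) ^ (j + 1)) ^ (-s') = 2 ^ s' * ((2⁻¹ : ℝ) ^ j) ^ (-s') := by
      rw [pow_succ, mul_rpow (by positivity) (by positivity), inv_rpow (by positivity),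
        rpow_neg (x := (2:ℝ)) (by positivity), inv_inv, mul_comm]
    rw [e1, e2]
    ring
  calc ∑ y ∈ F, ν y * max ‖x - y‖ (2⁻¹ ^ n) ^ (-s')
      ≤ ∑ y ∈ F, ν y * (1 + ∑ j ∈ Finset.range (n + 1),
          if ‖x - y‖ ≤ 2⁻¹ ^ j then ((2⁻¹ : ℝ) ^ (j + 1)) ^ (-s') else 0) := by
        gcongr with y
        · exact h0 y
        · exact max_rpow_neg_le hs'
    _ = ∑ y ∈ F, ν y + ∑ j ∈ Finset.range (n + 1), ((2⁻¹ : ℝ) ^ (j + 1)) ^ (-s') *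
          ∑ y ∈ F with ‖x - y‖ ≤ 2⁻¹ ^ j, ν y := by
        simp_rw [mul_add, mul_one, Finset.sum_add_distrib, Finset.mul_sum]
        rw [Finset.sum_comm]
        congr 1
        refine Finset.sum_congr rfl fun j _ => ?_
        rw [Finset.sum_filter]
        refine Finset.sum_congr rfl fun y _ => ?_
        split_ifs <;> ring
    _ ≤ C + ∑ j ∈ Finset.range (n + 1), ((2⁻¹ : ℝ) ^ (j + 1)) ^ (-s') *
          (C * (2⁻¹ ^ j) ^ s) := by
        gcongr with j hj
        exact hν _ (pow_le_pow_of_le_one (by norm_num) (by norm_num)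
          (Nat.lt_succ_iff.1 (Finset.mem_range.1 hj)))
    _ = C + C * 2 ^ s' * ∑ j ∈ Finset.range (n + 1), ((2⁻¹ : ℝ) ^ (s - s')) ^ j := by
        rw [Finset.mul_sum]
        congr 1
        exact Finset.sum_congr rfl fun j _ => hterm j
    _ ≤ C + C * 2 ^ s' * (1 - 2⁻¹ ^ (s - s'))⁻¹ := by
        gcongr
        rw [← tsum_geometric_of_lt_one hq0 hq1]
        exact (summable_geometric_of_lt_one hq0 hq1).sum_le_tsum _ fun _ _ => by positivity
    _ = _ := by ring

lemma exists_sum_gaussian_le (s : ℝ) : ∃ A : ℝ, 0 < A ∧ ∀ (C t₀ : ℝ) (F : Finset V)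
    (ν : V → ℝ) (x : V), 0 ≤ C → 0 < t₀ → (∀ x, 0 ≤ ν x) →
    (∀ r, t₀ ≤ r → ∑ y ∈ F with ‖x - y‖ ≤ r, ν y ≤ C * r ^ s) →
    ∀ t, t₀ ≤ t → ∑ y ∈ F, ν y * exp (-(‖x - y‖ / t) ^ 2) ≤ A * C * t ^ s := by
  have hsum : Summable fun n : ℕ => ((n : ℝ) + 1) ^ s * exp (-n) := by
    have h1 := (summable_nat_add_iff 1).2
      (Real.summable_pow_mul_exp_neg_nat_mul ⌈s⌉₊ (r := 1) one_pos)
    refine Summable.of_nonneg_of_le (fun n => by positivity) (fun n => ?_) (h1.mul_left (exp 1))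
    have h2 : ((n : ℝ) + 1) ^ s ≤ ((n : ℝ) + 1) ^ ⌈s⌉₊ := by
      rw [← rpow_natCast]
      exact rpow_le_rpow_of_exponent_le (by linarith [n.cast_nonneg (α := ℝ)]) (Nat.le_ceil s)
    calc ((n : ℝ) + 1) ^ s * exp (-n) ≤ ((n : ℝ) + 1) ^ ⌈s⌉₊ * exp (-n) := by gcongr
      _ = _ := by
        push_cast
        rw [mul_left_comm, ← exp_add]
        congr 2
        ring
  refine ⟨∑' n : ℕ, ((n : ℝ) + 1) ^ s * exp (-n),
    hsum.tsum_pos (fun n => by positivity) 0 (by positivity), ?_⟩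
  intro C t₀ F ν x hC ht₀ h0 hν t ht
  have ht0 : 0 < t := ht₀.trans_le ht
  rw [← Finset.sum_fiberwise_of_maps_to (s := F)
      (fun y hy => Finset.mem_image_of_mem (fun y => ⌊‖x - y‖ / t⌋₊) hy)]
  calc _ ≤ ∑ n ∈ F.image (fun y => ⌊‖x - y‖ / t⌋₊), C * t ^ s * (((n : ℝ) + 1) ^ s * exp (-n)) := by
        refine Finset.sum_le_sum fun n _ => ?_
        have h1 := hν ((n + 1) * t) (by nlinarith [n.cast_nonneg (α := ℝ)])
        rw [mul_rpow (by positivity) ht0.le] at h1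
        calc ∑ y ∈ F with ⌊‖x - y‖ / t⌋₊ = n, ν y * exp (-(‖x - y‖ / t) ^ 2)
            ≤ ∑ y ∈ F with ⌊‖x - y‖ / t⌋₊ = n, ν y * exp (-n) := by
              refine Finset.sum_le_sum fun y hy => ?_
              have hy' := (Finset.mem_filter.1 hy).2
              have h2 : (n : ℝ) ≤ ‖x - y‖ / t := by
                rw [← hy']; exact Nat.floor_le (by positivity)
              have h3 : (n : ℝ) ≤ (n : ℝ) ^ 2 := by exact_mod_cast Nat.le_self_pow two_ne_zero n
              have h4 : (n : ℝ) ^ 2 ≤ (‖x - y‖ / t) ^ 2 := by gcongr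
              exact mul_le_mul_of_nonneg_left (exp_le_exp.2 (by linarith)) (h0 y)
          _ ≤ ∑ y ∈ F with ‖x - y‖ ≤ (n + 1) * t, ν y * exp (-n) := by
              refine Finset.sum_le_sum_of_subset_of_nonneg ?_ fun y _ _ =>
                mul_nonneg (h0 y) (exp_pos _).le
              intro y hy
              simp only [Finset.mem_filter] at hy ⊢
              refine ⟨hy.1, ?_⟩
              have := Nat.lt_floor_add_one (‖x - y‖ / t)
              rw [hy.2, div_lt_iff₀ ht0] at this
              exact this.le
          _ = (∑ y ∈ F with ‖x - y‖ ≤ (n + 1) * t, ν y) * exp (-n) := by rw [Finset.sum_mul]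
          _ ≤ C * (((n : ℝ) + 1) ^ s * t ^ s) * exp (-n) := by gcongr
          _ = _ := by ring
    _ ≤ C * t ^ s * ∑' n : ℕ, ((n : ℝ) + 1) ^ s * exp (-n) := by
        rw [← Finset.mul_sum]
        gcongr
        exact hsum.sum_le_tsum _ fun _ _ => by positivity
    _ = _ := by ring

end Energy

section Covering

open Set Real MeasureTheory Metric

lemma exists_frostman_weights_of_isBounded {d : ℕ} {s : ℝ} (hs : 0 ≤ s)
    {S : Set (EuclideanSpace ℝ (Fin d))} (hS : Bornology.IsBounded S) :
    ∃ C : ℝ, 0 < C ∧ ∀ B ⊆ S, ∀ n : ℕ, ∃ (F : Finset (EuclideanSpace ℝ (Fin d)))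
      (ν : EuclideanSpace ℝ (Fin d) → ℝ) (U : Finset (ℕ × (Fin d → ℤ))), ↑F ⊆ B ∧
      (∀ x, 0 ≤ ν x) ∧
      (∀ x r, 2⁻¹ ^ n ≤ r → ∑ y ∈ F with ‖x - y‖ ≤ r, ν y ≤ C * r ^ s) ∧
      ∑ y ∈ F, ν y ≤ C ∧ (∀ b ∈ B, ∃ u ∈ U, dyadicCell u.1 b = u.2) ∧
      ∑ u ∈ U, ((2⁻¹ : ℝ) ^ u.1) ^ s = ∑ y ∈ F, ν y := by
  set T := (finite_image_dyadicCell hS 0).toFinset with hT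
  refine ⟨3 ^ d * 2 ^ s + T.card, by positivity, fun B hB n => ?_⟩
  obtain ⟨F, ν, U, hF, h0, hν, hU, hsum⟩ := exists_frostman_weights dyadicCell
    (fun _ _ _ _ => dyadicCell_eq_of_le) (fun j => ((2⁻¹ : ℝ) ^ j) ^ s)
    (fun j => by positivity) n ((finite_image_dyadicCell hS n).subset (image_mono hB))
  have htot : ∑ y ∈ F, ν y ≤ T.card := by
    have hmaps : ∀ y ∈ F, dyadicCell 0 y ∈ T := fun y hy => by
      rw [hT, Finite.mem_toFinset]
      exact mem_image_of_mem _ (hB (hF hy))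
    rw [← Finset.sum_fiberwise_of_maps_to hmaps, ← nsmul_one]
    refine Finset.sum_le_card_nsmul _ _ _ fun c _ => (hν 0 (Nat.zero_le n) c).trans ?_
    simp
  refine ⟨F, ν, U, hF, h0, fun x r hr => ?_, htot.trans ?_, hU, hsum⟩
  · exact sum_ball_le_of_dyadicCell hs (Nat.cast_nonneg _) h0 hν htot x hr
  · have : (0 : ℝ) ≤ 3 ^ d * 2 ^ s := by positivity
    linarith

lemma exists_pos_le_sum_of_dyadic_cover {d : ℕ} {s : ℝ} (hs : 0 < s)
    {S : Set (EuclideanSpace ℝ (Fin d))} (hS : μH[s] S ≠ 0) :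
    ∃ c : ℝ, 0 < c ∧ ∀ U : Finset (ℕ × (Fin d → ℤ)),
      (∀ x ∈ S, ∃ u ∈ U, dyadicCell u.1 x = u.2) → c ≤ ∑ u ∈ U, ((2⁻¹ : ℝ) ^ u.1) ^ s := by
  by_contra! hcon
  refine hS (hausdorffMeasure_eq_zero_of_dyadic_cover hs fun ε hε => ?_)
  obtain ⟨U, hU, hlt⟩ := hcon ε hε
  refine ⟨fun n => if n = 0 then U else ∅, fun x hx => ⟨0, by simpa using hU x hx⟩, ?_⟩
  rw [tsum_eq_single 0 (fun n hn => by simp [hn])]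
  simpa using ENNReal.ofReal_le_ofReal hlt.le

/-- A compact set of dimension less than `τ` is covered by finitely many dyadic balls of small
radius, at most `δ ^ (-τ)` of them at each scale `δ`. -/
lemma exists_finite_dyadic_cover_of_dimH_lt {D : Set ℝ} (hD : IsCompact D) {τ : ℝ} (hτ : 0 < τ)
    (hdim : dimH D < ENNReal.ofReal τ) (k₀ : ℕ) :
    ∃ (n : ℕ) (R : ℕ → Finset ℝ), (∀ k, ↑(R k) ⊆ D) ∧
      (∀ k, ((R k).card : ℝ) ≤ ((2⁻¹ : ℝ) ^ k) ^ (-τ)) ∧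
      ∀ t ∈ D, ∃ k ∈ Finset.Icc k₀ n, ∃ r ∈ R k, |t - r| ≤ 2⁻¹ ^ k := by
  classical
  have hzero : μH[τ] D = 0 := by
    have := hausdorffMeasure_of_dimH_lt (d := τ.toNNReal) (s := D) hdim
    rwa [Real.coe_toNNReal _ hτ.le] at this
  obtain ⟨ε, hε, hε'⟩ : ∃ ε : ℝ, 0 < ε ∧ 2 ^ τ * ε ≤ ((2⁻¹ : ℝ) ^ k₀) ^ τ :=
    ⟨((2⁻¹ : ℝ) ^ k₀) ^ τ / 2 ^ τ, by positivity, (mul_div_cancel₀ _ (by positivity)).le⟩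
  have h1 : (⨅ (t : ℕ → Set ℝ) (_ : D ⊆ ⋃ n, t n) (_ : ∀ n, ediam (t n) ≤ 1),
      ∑' n, ⨆ _ : (t n).Nonempty, ediam (t n) ^ τ) < ENNReal.ofReal ε := by
    refine lt_of_le_of_lt ?_ (ENNReal.ofReal_pos.2 hε)
    rw [← hzero, Measure.hausdorffMeasure_apply]
    exact le_iSup₂_of_le 1 one_pos le_rfl
  simp only [iInf_lt_iff] at h1
  obtain ⟨t, htD, -, ht⟩ := h1
  set f : ℕ → ENNReal := fun n => ⨆ _ : (t n).Nonempty, ediam (t n) ^ τ with hf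
  obtain ⟨e, he, hesum⟩ := ENNReal.exists_pos_sum_of_countable
    (ε := ENNReal.ofReal ε - ∑' n, f n) (tsub_pos_of_lt ht).ne' ℕ
  have hfe : ∑' n, (f n + e n) ≤ ENNReal.ofReal ε := by
    rw [ENNReal.tsum_add]
    exact (add_le_add_right hesum.le _).trans (add_tsub_cancel_of_le ht.le).le
  have hfin : ∀ n, f n + e n ≠ ⊤ := fun n =>
    ((ENNReal.le_tsum n).trans hfe).trans_lt ENNReal.ofReal_lt_top |>.ne
  set v : ℕ → ℝ := fun n => (f n + e n).toReal with hv
  have hv0 : ∀ n, 0 < v n := fun n =>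
    ENNReal.toReal_pos (ne_of_gt (lt_of_lt_of_le (by simpa using he n) le_add_self)) (hfin n)
  have hvsum : ∀ T : Finset ℕ, ∑ n ∈ T, v n ≤ ε := by
    intro T
    rw [← ENNReal.ofReal_le_ofReal_iff hε.le,
      ENNReal.ofReal_sum_of_nonneg fun n _ => (hv0 n).le]
    simp_rw [hv, ENNReal.ofReal_toReal (hfin _)]
    exact (ENNReal.sum_le_tsum T).trans hfe
  have hv1 : ∀ n, v n ≤ 1 := by
    intro n
    have h2 := hvsum {n}
    rw [Finset.sum_singleton] at h2
    have h3 : ((2⁻¹ : ℝ) ^ k₀) ^ τ ≤ 1 :=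
      rpow_le_one (by positivity) (pow_le_one₀ (by norm_num) (by norm_num)) hτ.le
    have h4 : (1 : ℝ) ≤ 2 ^ τ := one_le_rpow (by norm_num) hτ.le
    nlinarith
  have hk : ∀ n, ∃ k : ℕ, 2⁻¹ ^ (k + 1) < v n ^ τ⁻¹ ∧ v n ^ τ⁻¹ ≤ 2⁻¹ ^ k := fun n =>
    exists_nat_pow_near_of_lt_one (rpow_pos_of_pos (hv0 n) _)
      (rpow_le_one (hv0 n).le (hv1 n) (by positivity)) (by norm_num) (by norm_num)
  choose k hk1 hk2 using hk
  have hkv : ∀ n, ((2⁻¹ : ℝ) ^ k n) ^ τ ≤ 2 ^ τ * v n := by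
    intro n
    have h2 : (2⁻¹ : ℝ) ^ k n ≤ 2 * v n ^ τ⁻¹ := by
      have := hk1 n
      rw [pow_succ] at this
      linarith
    calc ((2⁻¹ : ℝ) ^ k n) ^ τ ≤ (2 * v n ^ τ⁻¹) ^ τ := by gcongr
      _ = _ := by
        rw [mul_rpow (by norm_num) (rpow_pos_of_pos (hv0 n) _).le, rpow_inv_rpow (hv0 n).le hτ.ne']
  have hsumk : ∀ T : Finset ℕ, ∑ n ∈ T, ((2⁻¹ : ℝ) ^ k n) ^ τ ≤ ((2⁻¹ : ℝ) ^ k₀) ^ τ := by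
    intro T
    calc _ ≤ ∑ n ∈ T, 2 ^ τ * v n := Finset.sum_le_sum fun n _ => hkv n
      _ = 2 ^ τ * ∑ n ∈ T, v n := by rw [Finset.mul_sum]
      _ ≤ 2 ^ τ * ε := by gcongr; exact hvsum T
      _ ≤ _ := hε'
  have hk₀ : ∀ n, k₀ ≤ k n := by
    intro n
    have h2 := hsumk {n}
    rw [Finset.sum_singleton, rpow_le_rpow_iff (by positivity) (by positivity) hτ] at h2
    exact (pow_le_pow_iff_right_of_lt_one₀ (by norm_num) (by norm_num)).1 h2
  have hdist : ∀ n, ∀ x ∈ t n, ∀ y ∈ t n, dist x y < 2⁻¹ ^ k n := by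
    intro n x hx y hy
    refine lt_of_lt_of_le ?_ (hk2 n)
    rw [lt_rpow_inv_iff_of_pos dist_nonneg (hv0 n).le hτ]
    have h2 : ENNReal.ofReal (dist x y ^ τ) < f n + e n := by
      have h3 : ENNReal.ofReal (dist x y ^ τ) ≤ f n := by
        rw [← ENNReal.ofReal_rpow_of_nonneg dist_nonneg hτ.le, ← edist_dist, hf]
        exact le_iSup_of_le ⟨x, hx⟩
          (ENNReal.rpow_le_rpow (edist_le_ediam_of_mem hx hy) hτ.le)
      exact h3.trans_lt (ENNReal.lt_add_right (ne_top_of_le_ne_top (hfin n) le_self_add)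
        (by simpa using (he n).ne'))
    exact (ENNReal.ofReal_lt_iff_lt_toReal (by positivity) (hfin n)).1 h2
  let P : Set ℕ := {n | (t n ∩ D).Nonempty}
  choose p hpt hpD using fun n : P => n.2
  obtain ⟨T, hT⟩ := hD.elim_finite_subcover (fun n : P => ball (p n) (2⁻¹ ^ k n))
    (fun n => isOpen_ball) (fun x hx => by
      obtain ⟨n, hn⟩ := mem_iUnion.1 (htD hx)
      exact mem_iUnion.2 ⟨⟨n, x, hn, hx⟩, hdist n _ hn _ (hpt ⟨n, x, hn, hx⟩)⟩)
  refine ⟨T.sup fun n : P => k n, fun j => (T.filter fun n : P => k n = j).image p, fun j => ?_,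
    fun j => ?_, fun x hx => ?_⟩
  · intro r hr
    obtain ⟨n, -, rfl⟩ := Finset.mem_image.1 (Finset.mem_coe.1 hr)
    exact hpD n
  · have h2 : ((T.filter fun n : P => k n = j).card : ℝ) * ((2⁻¹ : ℝ) ^ j) ^ τ ≤ 1 := by
      calc ((T.filter fun n : P => k n = j).card : ℝ) * ((2⁻¹ : ℝ) ^ j) ^ τ
          = ∑ n ∈ T.filter (fun n : P => k n = j), ((2⁻¹ : ℝ) ^ k n) ^ τ := by
            rw [← nsmul_eq_mul, ← Finset.sum_const]
            exact Finset.sum_congr rfl fun n hn => by rw [(Finset.mem_filter.1 hn).2]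
        _ = ∑ n ∈ (T.filter fun n : P => k n = j).map (Function.Embedding.subtype _),
              ((2⁻¹ : ℝ) ^ k n) ^ τ := by simp
        _ ≤ _ := hsumk _
        _ ≤ 1 := rpow_le_one (by positivity) (pow_le_one₀ (by norm_num) (by norm_num)) hτ.le
    rw [rpow_neg (by positivity), ← one_div, le_div_iff₀ (by positivity)]
    refine le_trans ?_ h2
    gcongr
    exact Finset.card_image_le
  · obtain ⟨n, hn, hxn⟩ := mem_iUnion₂.1 (hT hx)
    refine ⟨k n, Finset.mem_Icc.2 ⟨hk₀ n, Finset.le_sup (f := fun n : P => k n) hn⟩, p n,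
      Finset.mem_image_of_mem _ (Finset.mem_filter.2 ⟨hn, rfl⟩), ?_⟩
    rw [← Real.dist_eq]
    exact (mem_ball.1 hxn).le

end Covering

section PinnedNull

open Set Real MeasureTheory Filter Topology

/-- Points at positive distance from `E` whose pinned distance sets are small form a null set. -/
lemma hausdorffMeasure_eq_zero_of_dimH_pinnedDist_lt {d : ℕ} (hd : 2 ≤ d)
    {X E : Set (EuclideanSpace ℝ (Fin d))} (hX : Bornology.IsBounded X) (hE : IsCompact E)
    {r₀ r₁ a b s s' τ : ℝ} (hr₀ : 0 < r₀)
    (hdist : ∀ x ∈ X, ∀ y ∈ E, r₀ ≤ dist x y ∧ dist x y ≤ r₁) (hτ : 0 < τ)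
    (hpin : ∀ x ∈ X, dimH (pinnedDist x E) < ENNReal.ofReal τ) (ha : 0 < a) (hb : 0 < b)
    (hab : a + b < d) (hs0 : 0 ≤ s') (hs' : s' ≤ ((d : ℝ) - 1) / 2) (has : s' < a + 1)
    (hss : s' < s) (hexp : 0 < s' + b - (d - 1) - 2 * τ) (hEb : μH[b] E ≠ 0) :
    μH[s] X = 0 := by
  classical
  have hspos : 0 < s := by linarith
  obtain ⟨c, hc, hcE⟩ := exists_pos_le_sum_of_dyadic_cover hb hEb
  obtain ⟨CE, hCE, hFE⟩ := exists_frostman_weights_of_isBounded hb.le hE.isBounded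
  obtain ⟨CX, hCX, hFX⟩ := exists_frostman_weights_of_isBounded hspos.le hX
  choose G μ W hGE hμ0 hμball hμtot hWcov hWsum using hFE E subset_rfl
  have hμc : ∀ n, c ≤ ∑ y ∈ G n, μ n y := fun n => (hcE _ (hWcov n)).trans (hWsum n).le
  obtain ⟨A, hA, hgauss⟩ := exists_sum_gaussian_le (V := EuclideanSpace ℝ (Fin d)) b
  set D := CX * (1 + 2 ^ s' * (1 - 2⁻¹ ^ (s - s'))⁻¹) with hD
  obtain ⟨K, hK0, hK1, hK2, hK3, hK4⟩ : ∃ K : ℝ, 0 ≤ K ∧ D ≤ K ∧ CX ≤ K ∧ A * CE ≤ K ∧ CE ≤ K := by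
    refine ⟨max CX (max D (max (A * CE) CE)), hCX.le.trans (le_max_left _ _), ?_, ?_, ?_, ?_⟩ <;>
      simp
  obtain ⟨C, hC, hinc⟩ := exists_incidence_le (V := EuclideanSpace ℝ (Fin d)) (by simpa using hd)
    r₁ τ ha (by simpa using hab) hs0 (by simpa using hs') has hr₀
  simp only [finrank_euclideanSpace_fin] at hinc
  set e := (s' + b - (d - 1) - 2 * τ) / 2 with he
  have he0 : 0 < e := by rw [he]; linarith
  set θ : ℝ := 2⁻¹ ^ (e / 2) with hθ
  have hθ0 : 0 < θ := by positivity
  have hθ1 : θ < 1 := rpow_lt_one (by norm_num) (by norm_num) (by linarith)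
  have hθe : ∀ k : ℕ, ((2⁻¹ : ℝ) ^ k) ^ e = θ ^ k * θ ^ k := by
    intro k
    rw [hθ, ← mul_pow, ← rpow_add (by norm_num), add_halves, ← rpow_natCast, ← rpow_natCast,
      ← rpow_mul (by norm_num), ← rpow_mul (by norm_num), mul_comm]
  set c' : ℝ := c / 2 * (1 - θ) with hc'
  have hc'0 : 0 < c' := mul_pos (by linarith) (by linarith)
  let 𝒰 : Ultrafilter ℕ := hyperfilter ℕ
  let B : ℕ → Set (EuclideanSpace ℝ (Fin d)) := fun k => {x | x ∈ X ∧ ∃ R : Finset ℝ,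
    (R.card : ℝ) ≤ ((2⁻¹ : ℝ) ^ k) ^ (-τ) ∧ (∀ r ∈ R, r₀ ≤ r ∧ r ≤ r₁) ∧
    ∀ᶠ n in (𝒰 : Filter ℕ), c' * θ ^ k ≤
      ∑ r ∈ R, ∑ y ∈ G n with |‖x - y‖ - r| ≤ 2⁻¹ ^ k, μ n y}
  have hBX : ∀ k, B k ⊆ X := fun k x hx => hx.1
  have hcover : ∀ k₀, ∀ x ∈ X, ∃ k, k₀ ≤ k ∧ x ∈ B k := by
    intro k₀ x hx
    obtain ⟨N, R, hRD, hRcard, hRcov⟩ := exists_finite_dyadic_cover_of_dimH_lt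
      (hE.image (f := fun y => dist x y) (by fun_prop)) hτ (hpin x hx) k₀
    have h1 : ∀ᶠ n in (𝒰 : Filter ℕ), ∃ k ∈ (Finset.Icc k₀ N : Set ℕ), c' * θ ^ k ≤
        ∑ r ∈ R k, ∑ y ∈ G n with |‖x - y‖ - r| ≤ 2⁻¹ ^ k, μ n y := by
      refine Eventually.of_forall fun n => ?_
      by_contra! hcon
      have h2 : ∑ y ∈ G n, μ n y ≤ ∑ k ∈ Finset.Icc k₀ N,
          ∑ r ∈ R k, ∑ y ∈ G n with |‖x - y‖ - r| ≤ 2⁻¹ ^ k, μ n y := by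
        simp_rw [Finset.sum_filter]
        rw [Finset.sum_congr rfl fun k _ => Finset.sum_comm, Finset.sum_comm]
        refine Finset.sum_le_sum fun y hy => ?_
        obtain ⟨k, hk, r, hr, hyr⟩ := hRcov (dist x y) (mem_image_of_mem _ (hGE n hy))
        rw [dist_eq_norm] at hyr
        have hnn : ∀ (k : ℕ) (r : ℝ), 0 ≤ if |‖x - y‖ - r| ≤ 2⁻¹ ^ k then μ n y else 0 := by
          intro k r
          split_ifs
          exacts [hμ0 n y, le_rfl]
        calc μ n y = if |‖x - y‖ - r| ≤ 2⁻¹ ^ k then μ n y else 0 := by rw [if_pos hyr]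
          _ ≤ ∑ r ∈ R k, if |‖x - y‖ - r| ≤ 2⁻¹ ^ k then μ n y else 0 :=
            Finset.single_le_sum (f := fun r => if |‖x - y‖ - r| ≤ 2⁻¹ ^ k then μ n y else 0)
              (fun r _ => hnn k r) hr
          _ ≤ _ := Finset.single_le_sum
            (f := fun k => ∑ r ∈ R k, if |‖x - y‖ - r| ≤ 2⁻¹ ^ k then μ n y else 0)
            (fun k _ => Finset.sum_nonneg fun r _ => hnn k r) hk
      have h3 : ∑ k ∈ Finset.Icc k₀ N, c' * θ ^ k ≤ c / 2 := by
        rw [← Finset.mul_sum]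
        calc c' * ∑ k ∈ Finset.Icc k₀ N, θ ^ k ≤ c' * (1 - θ)⁻¹ := by
              rw [← tsum_geometric_of_lt_one hθ0.le hθ1]
              gcongr
              exact (summable_geometric_of_lt_one hθ0.le hθ1).sum_le_tsum _
                fun _ _ => by positivity
          _ = c / 2 := by
              rw [hc', mul_assoc, mul_inv_cancel₀ (by linarith), mul_one]
      have h4 := h2.trans (Finset.sum_le_sum fun k hk => (hcon k hk).le)
      linarith [hμc n]
    obtain ⟨k, hk, hev⟩ := (Ultrafilter.eventually_exists_mem_iff (Finset.finite_toSet _)).1 h1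
    refine ⟨k, (Finset.mem_Icc.1 (Finset.mem_coe.1 hk)).1, hx, R k, hRcard k, fun r hr => ?_, hev⟩
    obtain ⟨y, hy, rfl⟩ := hRD k hr
    exact hdist x hx y hy
  set M : ℝ := C * K ^ 2 / c' with hM
  have hM0 : 0 ≤ M := by positivity
  have hcells : ∀ k, ∃ U : Finset (ℕ × (Fin d → ℤ)),
      (∀ x ∈ B k, ∃ u ∈ U, dyadicCell u.1 x = u.2) ∧
      ∑ u ∈ U, ((2⁻¹ : ℝ) ^ u.1) ^ s ≤ M * θ ^ k := by
    intro k
    obtain ⟨F, ν, U, hFB, hν0, hνball, hνtot, hU, hUsum⟩ := hFX (B k) (hBX k) k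
    refine ⟨U, hU, ?_⟩
    rw [hUsum]
    have hR : ∀ x : EuclideanSpace ℝ (Fin d), ∃ R : Finset ℝ, x ∈ F →
        (R.card : ℝ) ≤ ((2⁻¹ : ℝ) ^ k) ^ (-τ) ∧ (∀ r ∈ R, r₀ ≤ r ∧ r ≤ r₁) ∧
        ∀ᶠ n in (𝒰 : Filter ℕ), c' * θ ^ k ≤
          ∑ r ∈ R, ∑ y ∈ G n with |‖x - y‖ - r| ≤ 2⁻¹ ^ k, μ n y := by
      intro x
      by_cases hx : x ∈ F
      · obtain ⟨R, hR⟩ := (hFB hx).2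
        exact ⟨R, fun _ => hR⟩
      · exact ⟨∅, fun h => absurd h hx⟩
    choose R hR using hR
    have hev : ∀ᶠ n in (𝒰 : Filter ℕ), k ≤ n ∧ ∀ x ∈ F, c' * θ ^ k ≤
          ∑ r ∈ R x, ∑ y ∈ G n with |‖x - y‖ - r| ≤ 2⁻¹ ^ k, μ n y := by
      refine ((eventually_ge_atTop k).filter_mono Nat.hyperfilter_le_atTop).and ?_
      exact (Filter.eventually_all_finset F).2 fun x hx => (hR x hx).2.2
    obtain ⟨n, hkn, hn⟩ := hev.exists
    have hpow : (2⁻¹ : ℝ) ^ n ≤ 2⁻¹ ^ k := pow_le_pow_of_le_one (by norm_num) (by norm_num) hkn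
    have hmain := hinc (2⁻¹ ^ k) K F (G n) ν (μ n) R (by positivity)
      (pow_le_one₀ (by norm_num) (by norm_num)) hK0 (fun x _ => hν0 x) (fun y _ => hμ0 n y)
      (fun x _ => (sum_rpow_neg_le hs0 hss hCX.le hνtot x (hνball x) hν0).trans hK1)
      (hνtot.trans hK2)
      (fun t ht y _ => (hgauss CE (2⁻¹ ^ n) (G n) (μ n) y hCE.le (by positivity) (hμ0 n)
        (hμball n y) t (hpow.trans ht)).trans (by
          have : 0 < t := lt_of_lt_of_le (by positivity) ht
          gcongr))
      ((hμtot n).trans hK4) (fun x hx => (hR x hx).2.1) (fun x hx => (hR x hx).1)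
    have hlow : (∑ x ∈ F, ν x) * (c' * θ ^ k) ≤ C * K ^ 2 * (θ ^ k * θ ^ k) := by
      rw [← hθe, Finset.sum_mul]
      exact (Finset.sum_le_sum fun x hx =>
        mul_le_mul_of_nonneg_left (hn x hx) (hν0 x)).trans hmain
    have hθk : 0 < θ ^ k := by positivity
    rw [hM, div_mul_eq_mul_div, le_div_iff₀ hc'0]
    refine le_of_mul_le_mul_right ?_ hθk
    linarith
  choose U hUcov hUsum using hcells
  refine hausdorffMeasure_eq_zero_of_dyadic_cover hspos fun ε hε => ?_
  have hlim : Tendsto (fun k₀ : ℕ => M * (1 - θ)⁻¹ * θ ^ k₀) atTop (𝓝 0) := by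
    simpa using (tendsto_pow_atTop_nhds_zero_of_lt_one hθ0.le hθ1).const_mul (M * (1 - θ)⁻¹)
  obtain ⟨k₀, hk₀⟩ := (hlim.eventually (gt_mem_nhds hε)).exists
  refine ⟨fun n => U (n + k₀), fun x hx => ?_, ?_⟩
  · obtain ⟨k, hk, hxk⟩ := hcover k₀ x hx
    exact ⟨k - k₀, by simpa [Nat.sub_add_cancel hk] using hUcov k x hxk⟩
  · have hgeo := (summable_geometric_of_lt_one hθ0.le hθ1).mul_left (M * θ ^ k₀)
    calc ∑' n, ENNReal.ofReal (∑ u ∈ U (n + k₀), ((2⁻¹ : ℝ) ^ u.1) ^ s)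
        ≤ ∑' n : ℕ, ENNReal.ofReal (M * θ ^ k₀ * θ ^ n) := by
          refine ENNReal.tsum_le_tsum fun n => ENNReal.ofReal_le_ofReal ?_
          refine (hUsum (n + k₀)).trans_eq ?_
          rw [pow_add]
          ring
      _ = ENNReal.ofReal (∑' n : ℕ, M * θ ^ k₀ * θ ^ n) :=
          (ENNReal.ofReal_tsum_of_nonneg (fun n => by positivity) hgeo).symm
      _ ≤ ENNReal.ofReal ε := by
          refine ENNReal.ofReal_le_ofReal ?_
          rw [tsum_mul_left, tsum_geometric_of_lt_one hθ0.le hθ1]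
          linarith

end PinnedNull

/-- Theorem 2: if `E ⊂ ℝ^d` is compact with `dim E = β`, `0 < τ < 1` and
`2τ + (d-1)/2 < β < 2τ + d - 1`, then
`dim {x : dim D_x(E) < τ} ≤ 2τ - β + d - 1`. -/
theorem stmt_4 (d : ℕ) (hd : 2 ≤ d) (E : Set (EuclideanSpace ℝ (Fin d)))
    (hEc : IsCompact E) (β τ : ℝ) (hβ : 0 < β) (hdim : dimH E = ENNReal.ofReal β)
    (hτ0 : 0 < τ) (hτ1 : τ < 1)
    (hlow : 2 * τ + ((d : ℝ) - 1) / 2 < β) (hhigh : β < 2 * τ + (d : ℝ) - 1) :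
    dimH {x : EuclideanSpace ℝ (Fin d) | dimH (pinnedDist x E) < ENNReal.ofReal τ}
      ≤ ENNReal.ofReal (2 * τ - β + (d : ℝ) - 1) := by
  set X := {x : EuclideanSpace ℝ (Fin d) | dimH (pinnedDist x E) < ENNReal.ofReal τ} with hX
  by_contra! hcon
  set s₀ : ℝ := 2 * τ - β + (d : ℝ) - 1 with hs₀
  have hs₀pos : 0 < s₀ := by rw [hs₀]; linarith
  obtain ⟨r, hr1, hr2⟩ := ENNReal.lt_iff_exists_nnreal_btwn.1 hcon
  have hr1' : s₀ < r := by
    rwa [← ENNReal.ofReal_coe_nnreal, ENNReal.ofReal_lt_ofReal_iff_of_nonneg hs₀pos.le] at hr1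
  have hβd : β ≤ d := by
    have h1 : dimH E ≤ d := by
      simpa using (dimH_mono (Set.subset_univ E)).trans_eq
        (Real.dimH_univ_eq_finrank (EuclideanSpace ℝ (Fin d)))
    rw [hdim, ← ENNReal.ofReal_natCast] at h1
    exact (ENNReal.ofReal_le_ofReal_iff (Nat.cast_nonneg d)).1 h1
  obtain ⟨s, hs1, hsr, hs2, hs3⟩ : ∃ s : ℝ, s₀ < s ∧ s ≤ r ∧ s ≤ ((d : ℝ) - 1) / 2 ∧
      s ≤ (d : ℝ) + 1 - β :=
    ⟨min r (min (((d : ℝ) - 1) / 2) ((d : ℝ) + 1 - β)),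
      lt_min hr1' (lt_min (by linarith) (by linarith)), min_le_left _ _,
      (min_le_right _ _).trans (min_le_left _ _), (min_le_right _ _).trans (min_le_right _ _)⟩
  obtain ⟨s', hs'1, hs'2⟩ := exists_between hs1
  obtain ⟨b, hb1, hb2⟩ := exists_between
    (show max 0 (β - (s' - s₀)) < β from max_lt hβ (by linarith))
  have hb0 : 0 < b := (le_max_left _ _).trans_lt hb1
  have hb3 : β - (s' - s₀) < b := (le_max_right _ _).trans_lt hb1
  obtain ⟨a, ha1, ha2⟩ := exists_between
    (show max 0 (s' - 1) < d - b from max_lt (by linarith) (by linarith))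
  have ha0 : 0 < a := (le_max_left _ _).trans_lt ha1
  have ha3 : s' - 1 < a := (le_max_right _ _).trans_lt ha1
  obtain ⟨x₀, -, hx₀⟩ := exists_mem_nhdsWithin_lt_dimH_of_lt_dimH hr2
  have hE' : ENNReal.ofReal b < dimH (E \ {x₀}) := by
    have h1 : dimH E ≤ dimH (E \ {x₀}) := by
      calc dimH E ≤ dimH ((E \ {x₀}) ∪ {x₀}) := dimH_mono (by simp)
        _ = _ := by rw [dimH_union, dimH_singleton, max_eq_left zero_le]
    refine lt_of_lt_of_le ?_ h1
    rwa [hdim, ENNReal.ofReal_lt_ofReal_iff hβ]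
  obtain ⟨p, ⟨-, hpx⟩, hp⟩ := exists_mem_nhdsWithin_lt_dimH_of_lt_dimH hE'
  have hdxp : 0 < dist x₀ p := dist_pos.2 fun h => hpx h.symm
  set ρ := dist x₀ p / 4 with hρ
  have hρ0 : 0 < ρ := by positivity
  have hXdim := hx₀ (X ∩ ball x₀ ρ)
    (Filter.inter_mem self_mem_nhdsWithin (mem_nhdsWithin_of_mem_nhds (ball_mem_nhds _ hρ0)))
  have hEdim := hp (E ∩ closedBall p ρ) (Filter.inter_mem
    (Filter.mem_of_superset self_mem_nhdsWithin Set.sdiff_subset)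
    (mem_nhdsWithin_of_mem_nhds (closedBall_mem_nhds _ hρ0)))
  have hzero : μH[s] (X ∩ ball x₀ ρ) = 0 := by
    refine hausdorffMeasure_eq_zero_of_dimH_pinnedDist_lt (E := E ∩ closedBall p ρ)
      hd (isBounded_ball.subset Set.inter_subset_right) (hEc.inter_right isClosed_closedBall)
      (r₀ := 2 * ρ) (r₁ := 6 * ρ) (a := a) (b := b) (s' := s') (τ := τ) (by positivity) ?_ hτ0 ?_
      ha0 hb0 (by linarith) (by linarith) (by linarith) (by linarith) hs'2 (by linarith) ?_
    · rintro x ⟨-, hx⟩ y ⟨-, hy⟩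
      rw [mem_ball] at hx
      rw [mem_closedBall] at hy
      have h1 := dist_triangle4 x₀ x y p
      have h2 := dist_triangle4 x x₀ p y
      rw [dist_comm x₀ x] at h1
      rw [dist_comm p y] at h2
      constructor <;> linarith
    · rintro x ⟨hx, -⟩
      exact (dimH_mono (Set.image_mono Set.inter_subset_left)).trans_lt hx
    · have := hausdorffMeasure_of_lt_dimH (d := b.toNNReal) hEdim
      rw [Real.coe_toNNReal _ hb0.le] at this
      simp [this]
  refine absurd hXdim (not_lt.2 ?_)
  have h1 : dimH (X ∩ ball x₀ ρ) ≤ s.toNNReal := by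
    refine dimH_le_of_hausdorffMeasure_ne_top ?_
    rw [Real.coe_toNNReal _ (by linarith), hzero]
    exact ENNReal.zero_ne_top
  exact h1.trans (ENNReal.coe_le_coe.2 (Real.toNNReal_le_iff_le_coe.2 hsr))
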